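/- arXiv:2003.05152 — 6 statements merged into one kernel-verified Lean document; each statement's English description precedes it below -/
import Mathlib

section
/- Let K be a finite index set and let {Q_k}_{k∈K}, A, B ∈ ℂ[x₁,…,xₙ] be homogeneous quadratic polynomials such that ∏_{k∈K} Q_k ∈ √⟨A,B⟩. Then at least one of the following holds: (i) there is k ∈ K such that Q_k lies in the ℂ-linear span of A and B; (ii) there exist (α,β) ∈ ℂ² ∖ {(0,0)} and linear forms c, d such that αA + βB = c·d; (iii) there exist linear forms c and d such that A ∈ ⟨c,d⟩, B ∈ ⟨c,d⟩, and Q_k ∈ ⟨c,d⟩ for some k ∈ K (i.e., setting c = d = 0 makes A, B and one of the Q_k vanish). -/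
open MvPolynomial

namespace MvPolynomial

variable {σ : Type*}

/-- The factors of a nonzero homogeneous polynomial are homogeneous. -/
lemma IsHomogeneous.exists_isHomogeneous_of_mul {f g : MvPolynomial σ ℂ} {N : ℕ}
    (h : (f * g).IsHomogeneous N) (h0 : f * g ≠ 0) :
    ∃ a b, a + b = N ∧ f.IsHomogeneous a ∧ g.IsHomogeneous b := by
  have hf0 : f ≠ 0 := left_ne_zero_of_mul h0
  have hg0 : g ≠ 0 := right_ne_zero_of_mul h0
  have key : ∀ f : MvPolynomial σ ℂ, f ≠ 0 → ∃ a : ℕ, (f : MvPowerSeries σ ℂ).order = a ∧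
      a ≤ f.totalDegree ∧ (f.totalDegree ≤ a → f.IsHomogeneous a) := by
    intro f hf
    have hf' : (f : MvPowerSeries σ ℂ) ≠ 0 := by simpa using hf
    have ho := MvPowerSeries.ne_zero_iff_order_finite.1 hf'
    refine ⟨_, ho.symm, ?_, ?_⟩
    · obtain ⟨d, hd, hd'⟩ := MvPowerSeries.exists_coeff_ne_zero_and_order ho
      rw [coeff_coe] at hd
      have h1 : d.degree ≤ f.totalDegree := le_totalDegree (mem_support_iff.2 hd)
      rw [← hd']
      simpa using h1
    · intro hle d hd
      have h1 : d.degree ≤ f.totalDegree := le_totalDegree (mem_support_iff.2 hd)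
      have h2 : (f : MvPowerSeries σ ℂ).order ≤ d.degree :=
        MvPowerSeries.order_le (by rwa [coeff_coe])
      rw [← ho] at h2
      have h3 := Nat.cast_le.1 h2
      refine (DFunLike.congr_fun Finsupp.degree_eq_weight_one d).symm.trans ?_
      exact le_antisymm (h1.trans hle) h3
  obtain ⟨a, ha, haf, hfa⟩ := key f hf0
  obtain ⟨b, hb, hbg, hgb⟩ := key g hg0
  have hdeg : f.totalDegree + g.totalDegree = N := by
    rw [← totalDegree_mul_of_isDomain hf0 hg0, h.totalDegree h0]
  have hord : (N : ℕ∞) ≤ ((f * g : MvPolynomial σ ℂ) : MvPowerSeries σ ℂ).order := by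
    refine MvPowerSeries.nat_le_order fun d hd => ?_
    rw [coeff_coe]
    exact h.coeff_eq_zero hd.ne
  rw [coe_mul, MvPowerSeries.order_mul, ha, hb, ← Nat.cast_add, Nat.cast_le] at hord
  exact ⟨a, b, by lia, hfa (by lia), hgb (by lia)⟩

lemma IsHomogeneous.eq_C {f : MvPolynomial σ ℂ} (h : f.IsHomogeneous 0) : ∃ c, f = C c :=
  ⟨_, (totalDegree_eq_zero_iff_eq_C).1 (Nat.le_zero.1 h.totalDegree_le)⟩

/-- Divisibility between homogeneous polynomials has a homogeneous quotient. -/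
lemma IsHomogeneous.exists_eq_mul_of_dvd {f g : MvPolynomial σ ℂ} {m l : ℕ}
    (hg : g.IsHomogeneous m) (hf : f.IsHomogeneous (m + l)) (h : g ∣ f) :
    ∃ w, w.IsHomogeneous l ∧ f = g * w := by
  obtain ⟨w, rfl⟩ := h
  by_cases h0 : g * w = 0
  · exact ⟨0, isHomogeneous_zero _ _ _, by simpa using h0⟩
  obtain ⟨a, b, hab, ha, hb⟩ := hf.exists_isHomogeneous_of_mul h0
  have := ha.inj_right hg (left_ne_zero_of_mul h0)
  obtain rfl : b = l := by lia
  exact ⟨w, hb, rfl⟩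

lemma IsHomogeneous.exists_eq_C_mul_of_dvd {f g : MvPolynomial σ ℂ} {m : ℕ}
    (hg : g.IsHomogeneous m) (hf : f.IsHomogeneous m) (h : g ∣ f) : ∃ c, f = C c * g := by
  obtain ⟨w, hw, rfl⟩ := hg.exists_eq_mul_of_dvd (l := 0) hf h
  obtain ⟨c, rfl⟩ := hw.eq_C
  exact ⟨c, mul_comm _ _⟩

lemma IsHomogeneous.eq_zero_of_dvd_of_lt {f g : MvPolynomial σ ℂ} {m l : ℕ}
    (hg : g.IsHomogeneous m) (hf : f.IsHomogeneous l) (hlt : l < m) (h : g ∣ f) : f = 0 := by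
  obtain ⟨w, rfl⟩ := h
  by_contra h0
  obtain ⟨a, b, hab, ha, hb⟩ := hf.exists_isHomogeneous_of_mul h0
  have := ha.inj_right hg (left_ne_zero_of_mul h0)
  lia

lemma IsHomogeneous.isUnit_of_ne_zero {f : MvPolynomial σ ℂ} (h : f.IsHomogeneous 0)
    (h0 : f ≠ 0) : IsUnit f := by
  obtain ⟨c, rfl⟩ := h.eq_C
  exact (isUnit_iff_ne_zero.2 (by simpa using h0)).map C

lemma IsHomogeneous.not_isUnit {f : MvPolynomial σ ℂ} {m : ℕ} (h : f.IsHomogeneous m)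
    (hm : 0 < m) : ¬ IsUnit f := fun hu =>
  one_ne_zero (h.eq_zero_of_dvd_of_lt (isHomogeneous_one σ ℂ) hm hu.dvd)

lemma IsHomogeneous.irreducible_of_one {f : MvPolynomial σ ℂ} (h : f.IsHomogeneous 1)
    (h0 : f ≠ 0) : Irreducible f := by
  refine ⟨h.not_isUnit one_pos, fun {g k} hgk => ?_⟩
  subst hgk
  obtain ⟨a, b, hab, ha, hb⟩ := h.exists_isHomogeneous_of_mul h0
  obtain rfl | rfl : a = 0 ∨ b = 0 := by lia
  · exact .inl (ha.isUnit_of_ne_zero (left_ne_zero_of_mul h0))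
  · exact .inr (hb.isUnit_of_ne_zero (right_ne_zero_of_mul h0))

/-- A homogeneous quadratic is irreducible unless it is a product of two linear forms. -/
lemma IsHomogeneous.irreducible_or_exists_eq_mul {f : MvPolynomial σ ℂ} (h : f.IsHomogeneous 2) :
    Irreducible f ∨ ∃ c d : MvPolynomial σ ℂ, c.IsHomogeneous 1 ∧ d.IsHomogeneous 1 ∧
      f = c * d := by
  by_cases h0 : f = 0
  · exact .inr ⟨0, 0, isHomogeneous_zero _ _ _, isHomogeneous_zero _ _ _, by simpa using h0⟩
  refine or_iff_not_imp_right.2 fun hne => ⟨h.not_isUnit two_pos, fun {g k} hgk => ?_⟩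
  subst hgk
  obtain ⟨a, b, hab, ha, hb⟩ := h.exists_isHomogeneous_of_mul h0
  obtain rfl | rfl | ⟨rfl, rfl⟩ : a = 0 ∨ b = 0 ∨ (a = 1 ∧ b = 1) := by lia
  · exact .inl (ha.isUnit_of_ne_zero (left_ne_zero_of_mul h0))
  · exact .inr (hb.isUnit_of_ne_zero (right_ne_zero_of_mul h0))
  · exact absurd ⟨g, k, ha, hb, rfl⟩ hne

/-- A linear form is the sum of its coefficients times the variables. -/
lemma IsHomogeneous.eq_sum_of_one [Fintype σ] {f : MvPolynomial σ ℂ} (h : f.IsHomogeneous 1) :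
    ∃ a : σ → ℂ, f = ∑ i, C (a i) * X i := by
  have h1 : f ∈ homogeneousSubmodule σ ℂ 1 := h
  rw [homogeneousSubmodule_one_eq_span_X] at h1
  obtain ⟨a, ha⟩ := (Submodule.mem_span_range_iff_exists_fun ℂ).1 h1
  exact ⟨a, by simp [← ha, smul_eq_C_mul]⟩

/-- Elimination of a linear form: an endomorphism of the polynomial ring whose kernel is `⟨a⟩` and
which is the identity modulo `⟨a⟩`. -/
lemma IsHomogeneous.exists_elimination [Fintype σ] {a : MvPolynomial σ ℂ}
    (ha : a.IsHomogeneous 1) :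
    ∃ s : MvPolynomial σ ℂ →ₐ[ℂ] MvPolynomial σ ℂ, s a = 0 ∧ (∀ f, a ∣ f - s f) ∧
      ∀ f m, f.IsHomogeneous m → (s f).IsHomogeneous m := by
  classical
  by_cases h0 : a = 0
  · exact ⟨AlgHom.id _ _, by simp [h0], by simp, by simp⟩
  obtain ⟨e, rfl⟩ := ha.eq_sum_of_one
  set a := ∑ i, C (e i) * X i with hadef
  obtain ⟨i, hi⟩ : ∃ i, e i ≠ 0 := by
    by_contra! h
    exact h0 (by simp [hadef, h])
  let t : σ → MvPolynomial σ ℂ := fun j => if j = i then X i - C (e i)⁻¹ * a else X j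
  have ht : ∀ j, X j - MvPolynomial.aeval t (X j : MvPolynomial σ ℂ) = if j = i then C (e i)⁻¹ * a else 0 := by
    intro j
    rw [aeval_X]
    by_cases hj : j = i
    · subst hj; simp [t]
    · simp [t, hj]
  refine ⟨MvPolynomial.aeval t, ?_, fun f => ?_, fun f m hf => ?_⟩
  · have : a - MvPolynomial.aeval t a = a := by
      calc a - MvPolynomial.aeval t a = ∑ j, C (e j) * (X j - MvPolynomial.aeval t (X j : MvPolynomial σ ℂ)) := by
            rw [hadef, map_sum, ← Finset.sum_sub_distrib]
            refine Finset.sum_congr rfl fun j _ => ?_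
            rw [map_mul, mul_sub]
            simp [algebraMap_eq]
        _ = a := by
            simp only [ht, mul_ite, mul_zero, Finset.sum_ite_eq', Finset.mem_univ, if_true]
            rw [← mul_assoc, ← MvPolynomial.C_mul, mul_inv_cancel₀ hi, C_1, one_mul]
    simpa using this
  · have hq : (Ideal.Quotient.mkₐ ℂ (Ideal.span {a})).comp (MvPolynomial.aeval t) =
        Ideal.Quotient.mkₐ ℂ (Ideal.span {a}) := by
      refine algHom_ext fun j => ?_
      refine ((Ideal.Quotient.mk_eq_mk_iff_sub_mem _ _).2 ?_).symm
      change X j - MvPolynomial.aeval t (X j) ∈ _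
      rw [ht, Ideal.mem_span_singleton]
      split_ifs
      · exact dvd_mul_left _ _
      · exact dvd_zero _
    rw [← Ideal.mem_span_singleton, ← Ideal.Quotient.mk_eq_mk_iff_sub_mem]
    exact (DFunLike.congr_fun hq f).symm
  · have := hf.aeval t (n := 1) fun j => ?_
    · simpa using this
    · by_cases hj : j = i
      · simpa [t, hj] using (isHomogeneous_X ℂ i).sub (ha.C_mul _)
      · simpa [t, hj] using isHomogeneous_X ℂ j

/-- An ideal generated by two linear forms is prime. -/
lemma isPrime_span_pair_of_isHomogeneous_one [Fintype σ] {c d : MvPolynomial σ ℂ}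
    (hc : c.IsHomogeneous 1) (hd : d.IsHomogeneous 1) : (Ideal.span {c, d}).IsPrime := by
  obtain ⟨s, hs0, hs, hsh⟩ := hc.exists_elimination
  obtain ⟨t, ht0, ht, -⟩ := (hsh d 1 hd).exists_elimination
  have hcI : c ∈ Ideal.span {c, d} := Ideal.subset_span (by simp)
  have hdI : d ∈ Ideal.span {c, d} := Ideal.subset_span (by simp)
  have hsI : ∀ f, f - s f ∈ Ideal.span {c, d} := fun f => Ideal.mem_of_dvd _ (hs f) hcI
  have hsd : s d ∈ Ideal.span {c, d} := by simpa using sub_mem hdI (hsI d)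
  have : Ideal.span {c, d} = RingHom.ker (t.comp s) := by
    refine le_antisymm (Ideal.span_le.2 ?_) fun f hf => ?_
    · rintro x (rfl | rfl)
      · simp [RingHom.mem_ker, hs0]
      · simpa [RingHom.mem_ker] using ht0
    · have h1 : t (s f) = 0 := hf
      have h2 := Ideal.mem_of_dvd _ (ht (s f)) hsd
      rw [h1, sub_zero] at h2
      simpa using add_mem (hsI f) h2
  rw [this]
  exact RingHom.ker_isPrime _

/-- A binary quadratic form over `ℂ` is a product of two linear forms. -/
lemma exists_eq_mul_of_binary {u w : MvPolynomial σ ℂ} (hu : u.IsHomogeneous 1)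
    (hw : w.IsHomogeneous 1) (α β γ : ℂ) :
    ∃ c d : MvPolynomial σ ℂ, c.IsHomogeneous 1 ∧ d.IsHomogeneous 1 ∧
      C α * u ^ 2 + C β * (u * w) + C γ * w ^ 2 = c * d := by
  by_cases hα : α = 0
  · exact ⟨w, C β * u + C γ * w, hw, (hu.C_mul _).add (hw.C_mul _), by simp [hα]; ring⟩
  obtain ⟨s, hs⟩ := IsAlgClosed.exists_pow_nat_eq (β ^ 2 - 4 * α * γ) two_pos
  refine ⟨C α * u + C ((β + s) / 2) * w, u + C ((β - s) / (2 * α)) * w,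
    (hu.C_mul _).add (hw.C_mul _), hu.add (hw.C_mul _), ?_⟩
  have h1 : β = α * ((β - s) / (2 * α)) + (β + s) / 2 := by field_simp; ring
  have h2 : γ = (β + s) / 2 * ((β - s) / (2 * α)) := by
    field_simp
    linear_combination hs
  have h1' := congrArg (C : ℂ → MvPolynomial σ ℂ) h1
  have h2' := congrArg (C : ℂ → MvPolynomial σ ℂ) h2
  simp only [C_add, C_mul] at h1' h2'
  rw [h1', h2']
  ring

/-- A polynomial vanishing on the zero set of an irreducible polynomial is divisible by it. -/
lemma dvd_of_forall_eval_eq_zero [Finite σ] {b f : MvPolynomial σ ℂ} (hb : Irreducible b)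
    (h : ∀ v, eval v b = 0 → eval v f = 0) : b ∣ f := by
  have : (Ideal.span {b}).IsPrime := (Ideal.span_singleton_prime hb.ne_zero).2 hb.prime
  rw [← Ideal.mem_span_singleton, ← IsPrime.vanishingIdeal_zeroLocus (K := ℂ) (Ideal.span {b})]
  intro v hv
  have := hv b (Ideal.mem_span_singleton_self b)
  rw [aeval_eq_eval] at this ⊢
  exact h v this

/-- Divisibility criterion in the case where the pencil contains a quadratic `x * a₁ + a₀` that is
linear in `x` and a quadratic `b`. -/
lemma exists_eq_add_of_dvd_resultant_linear [Fintype σ] {x a₁ a₀ b l r : MvPolynomial σ ℂ} {q : ℂ}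
    (hx : x.IsHomogeneous 1) (ha₁ : a₁.IsHomogeneous 1) (ha₁0 : a₁ ≠ 0) (ha₀ : a₀.IsHomogeneous 2)
    (hb : b.IsHomogeneous 2) (hbirr : Irreducible b)
    (hl : l.IsHomogeneous 1) (hr : r.IsHomogeneous 2)
    (hsplit : ∀ t : ℂ, ∀ c d : MvPolynomial σ ℂ, c.IsHomogeneous 1 → d.IsHomogeneous 1 →
      x * a₁ + a₀ + C t * b ≠ c * d)
    (hlin : ∀ c d : MvPolynomial σ ℂ, c.IsHomogeneous 1 → d.IsHomogeneous 1 →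
      x * a₁ + a₀ ∈ Ideal.span {c, d} → b ∉ Ideal.span {c, d})
    (hdvd : b ∣ C q * a₀ ^ 2 - a₀ * a₁ * l + a₁ ^ 2 * r) :
    ∃ μ ν : ℂ, C q * x ^ 2 + x * l + r = C μ * (x * a₁ + a₀) + C ν * b := by
  obtain ⟨s, hs0, hs, hsh⟩ := ha₁.exists_elimination
  have hker : ∀ f, s f = 0 → a₁ ∣ f := fun f hf => by simpa [hf] using hs f
  have hpa : Prime a₁ := (ha₁.irreducible_of_one ha₁0).prime
  have hpb : Prime b := hbirr.prime
  have hab : ¬ a₁ ∣ b := by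
    intro h
    obtain ⟨w, hw, rfl⟩ := ha₁.exists_eq_mul_of_dvd (l := 1) hb h
    exact (hbirr.isUnit_or_isUnit rfl).elim (ha₁.not_isUnit one_pos) (hw.not_isUnit one_pos)
  have hba : ¬ b ∣ a₁ := fun h => ha₁0 (hb.eq_zero_of_dvd_of_lt ha₁ one_lt_two h)
  have hsb0 : s b ≠ 0 := fun h => hab (hker b h)
  have hsb := hsh b 2 hb
  have hsa := hsh a₀ 2 ha₀
  have hcop : IsRelPrime (s b) (s a₀) := by
    refine WfDvdMonoid.isRelPrime_of_no_irreducible_factors (fun h => hsb0 h.1)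
      fun g hg hgb hga => ?_
    obtain ⟨w, hw⟩ := hgb
    obtain ⟨i, j, hij, hi, hj⟩ := (hw ▸ hsb).exists_isHomogeneous_of_mul (hw ▸ hsb0)
    obtain rfl | rfl | ⟨rfl, rfl⟩ : i = 0 ∨ i = 1 ∨ (i = 2 ∧ j = 0) := by lia
    · exact hg.not_isUnit (hi.isUnit_of_ne_zero hg.ne_zero)
    · have hmem : ∀ f, g ∣ s f → f ∈ Ideal.span {a₁, g} := fun f hf => by
        have h1 : f - s f ∈ Ideal.span {a₁, g} :=
          Ideal.mem_of_dvd _ (hs f) (Ideal.subset_span (by simp))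
        have h2 : s f ∈ Ideal.span {a₁, g} := Ideal.mem_of_dvd _ hf (Ideal.subset_span (by simp))
        simpa using add_mem h1 h2
      refine hlin a₁ g ha₁ hi (hmem _ ?_) (hmem b ⟨w, hw⟩)
      simpa [hs0] using hga
    · have hwu : IsUnit w := hj.isUnit_of_ne_zero (right_ne_zero_of_mul (hw ▸ hsb0))
      have hba₀ : s b ∣ s a₀ := by rw [hw]; exact (hwu.mul_right_dvd).2 hga
      obtain ⟨c, hc⟩ := hsb.exists_eq_C_mul_of_dvd hsa hba₀
      have h1 : s (a₀ - C c * b) = 0 := by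
        rw [map_sub, map_mul, algHom_C, algebraMap_eq, hc, sub_self]
      obtain ⟨w', hw', h2⟩ := ha₁.exists_eq_mul_of_dvd (l := 1) (ha₀.sub (hb.C_mul c)) (hker _ h1)
      refine hsplit (-c) a₁ (x + w') ha₁ (hx.add hw') ?_
      rw [C_neg]
      linear_combination h2
  have hq : q = 0 := by
    by_contra hq
    have h1 := map_dvd s hdvd
    simp only [map_add, map_sub, map_mul, map_pow, hs0, algHom_C, algebraMap_eq, mul_zero, zero_mul,
      sub_zero, add_zero, ne_eq, OfNat.ofNat_ne_zero, not_false_eq_true, zero_pow] at h1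
    have hu : IsUnit (C q : MvPolynomial σ ℂ) := (isUnit_iff_ne_zero.2 hq).map C
    have h2 : s b ∣ s a₀ ^ 2 := (hu.dvd_mul_left).1 h1
    exact hsb.not_isUnit two_pos ((hcop.pow_right (n := 2)).isUnit_of_dvd h2)
  subst hq
  obtain ⟨K, hK⟩ := hdvd
  obtain ⟨K, rfl⟩ : a₁ ∣ K := by
    refine (hpa.dvd_or_dvd (a := b) ⟨a₁ * r - a₀ * l, ?_⟩).resolve_left hab
    rw [← hK, C_0]
    ring
  have hK' : a₁ * r - a₀ * l = b * K := by
    apply mul_left_cancel₀ ha₁0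
    rw [C_0] at hK
    linear_combination hK
  have hsl : s l = 0 := by
    have h1 : s b ∣ s a₀ * s l := by
      refine ⟨- s K, ?_⟩
      have := congrArg s hK'
      simp only [map_sub, map_mul, hs0] at this
      linear_combination -this
    exact hsb.eq_zero_of_dvd_of_lt (hsh l 1 hl) one_lt_two (hcop.dvd_of_dvd_mul_left h1)
  obtain ⟨μ, rfl⟩ := ha₁.exists_eq_C_mul_of_dvd hl (hker l hsl)
  obtain ⟨ν, hν⟩ := hb.exists_eq_C_mul_of_dvd (hr.sub (ha₀.C_mul μ))
    ((hpb.dvd_or_dvd (a := a₁) ⟨K, by linear_combination hK'⟩).resolve_left hba)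
  refine ⟨μ, ν, ?_⟩
  rw [C_0]
  linear_combination hν

/-- Divisibility criterion in the case where the pencil contains a quadratic `z ^ 2 - a` and a
quadratic `b`. -/
lemma exists_eq_add_of_dvd_resultant_square [Fintype σ] {z a b l r : MvPolynomial σ ℂ} {q : ℂ}
    (hz : z.IsHomogeneous 1) (ha : a.IsHomogeneous 2) (hb : b.IsHomogeneous 2)
    (hbsplit : ∀ c d : MvPolynomial σ ℂ, c.IsHomogeneous 1 → d.IsHomogeneous 1 → b ≠ c * d)
    (hl : l.IsHomogeneous 1) (hr : r.IsHomogeneous 2)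
    (hsplit : ∀ t : ℂ, ∀ c d : MvPolynomial σ ℂ, c.IsHomogeneous 1 → d.IsHomogeneous 1 →
      z ^ 2 - a + C t * b ≠ c * d)
    (hdvd : b ∣ (r + C q * a) ^ 2 - a * l ^ 2) :
    ∃ μ ν : ℂ, C q * z ^ 2 + z * l + r = C μ * (z ^ 2 - a) + C ν * b := by
  have hbirr : Irreducible b := hb.irreducible_or_exists_eq_mul.resolve_right
    fun ⟨c, d, hc, hd, h⟩ => hbsplit c d hc hd h
  have hpb : Prime b := hbirr.prime
  have hr' : (r + C q * a).IsHomogeneous 2 := hr.add (ha.C_mul q)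
  by_cases hl0 : l = 0
  · subst hl0
    have h1 : b ∣ r + C q * a := hpb.dvd_of_dvd_pow (n := 2) (by simpa using hdvd)
    obtain ⟨ν, hν⟩ := hb.exists_eq_C_mul_of_dvd hr' h1
    exact ⟨q, ν, by linear_combination hν⟩
  exfalso
  generalize r + C q * a = r at hr' hdvd
  have hbl : ¬ b ∣ l := fun h => hl0 (hb.eq_zero_of_dvd_of_lt hl one_lt_two h)
  have hnot : ∀ m : MvPolynomial σ ℂ, m.IsHomogeneous 1 → ¬ b ∣ m ^ 2 - a := by
    intro m hm h
    obtain ⟨c, hc⟩ := hb.exists_eq_C_mul_of_dvd ((hm.pow 2).sub ha) h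
    refine hsplit (-c) (z - m) (z + m) (hz.sub hm) (hz.add hm) ?_
    rw [C_neg]
    linear_combination hc
  obtain ⟨s, hs0, hs, hsh⟩ := hl.exists_elimination
  have hker : ∀ f, s f = 0 → l ∣ f := fun f hf => by simpa [hf] using hs f
  have hss : ∀ f, s (s f) = s f := fun f => by
    have h1 := map_dvd s (hs f)
    rw [hs0, zero_dvd_iff, map_sub, sub_eq_zero] at h1
    exact h1.symm
  have hsC : ∀ c : ℂ, s (C c) = C c := fun c => by rw [algHom_C, algebraMap_eq]
  have hsb0 : s b ≠ 0 := by
    intro h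
    obtain ⟨w, hw, h1⟩ := hl.exists_eq_mul_of_dvd (l := 1) hb (hker b h)
    exact hbsplit l w hl hw h1
  have hsb := hsh b 2 hb
  obtain ⟨K, hK⟩ := hdvd
  have hsK : s r ^ 2 = s b * s K := by
    have := congrArg s hK
    simpa [hs0] using this
  have hbr : ¬ s b ∣ s r := by
    intro h
    obtain ⟨μ, hμ⟩ := hsb.exists_eq_C_mul_of_dvd (hsh r 2 hr') h
    obtain ⟨m, hm, h1⟩ := hl.exists_eq_mul_of_dvd (l := 1) (hr'.sub (hb.C_mul μ))
      (hker _ (by rw [map_sub, map_mul, hsC, hμ, sub_self]))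
    refine hnot m hm ?_
    have h2 : b ∣ l ^ 2 * (m ^ 2 - a) := by
      refine ⟨K - C μ * (r + l * m), ?_⟩
      linear_combination hK - (r + l * m) * h1
    exact (hpb.dvd_or_dvd h2).resolve_left fun h => hbl (hpb.dvd_of_dvd_pow h)
  obtain hirr | ⟨u, v, hu, hv, huv⟩ := hsb.irreducible_or_exists_eq_mul
  · exact hbr (hirr.prime.dvd_of_dvd_pow ⟨_, hsK⟩)
  -- modulo `l`, the quadratic `b` is a multiple of the square of a linear form
  obtain ⟨κ, u, p, hu, hsu, hu0, hbu, hru, hup⟩ : ∃ (κ : ℂ) (u p : MvPolynomial σ ℂ),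
      u.IsHomogeneous 1 ∧ s u = u ∧ u ≠ 0 ∧ s b = C κ * u ^ 2 ∧ s r = u * p ∧
        ¬ u ∣ p := by
    have huv' : s b = s u * s v := by rw [← hss, huv, map_mul]
    have hu0 : s u ≠ 0 := left_ne_zero_of_mul (huv' ▸ hsb0)
    have hv0 : s v ≠ 0 := right_ne_zero_of_mul (huv' ▸ hsb0)
    have hpu := ((hsh u 1 hu).irreducible_of_one hu0).prime
    have hpv := ((hsh v 1 hv).irreducible_of_one hv0).prime
    obtain ⟨p, hp⟩ : s u ∣ s r :=
      hpu.dvd_of_dvd_pow (n := 2) (by rw [hsK, huv', mul_assoc]; exact dvd_mul_right _ _)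
    have hvr : s v ∣ s r :=
      hpv.dvd_of_dvd_pow (n := 2) (by rw [hsK, huv']; exact ⟨s u * s K, by ring⟩)
    have hvp : ¬ s v ∣ p := fun ⟨w, hw⟩ => hbr ⟨w, by rw [hp, huv', hw, mul_assoc]⟩
    obtain ⟨κ, hκ⟩ := (hsh v 1 hv).exists_eq_C_mul_of_dvd (hsh u 1 hu)
      ((hpv.dvd_or_dvd (hp ▸ hvr)).resolve_right hvp)
    have hκ0 : κ ≠ 0 := by rintro rfl; simp [hκ] at hu0
    have hCu : IsUnit (C κ : MvPolynomial σ ℂ) := (isUnit_iff_ne_zero.2 hκ0).map C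
    exact ⟨κ, s v, C κ * p, hsh v 1 hv, hss v, hv0, by rw [huv', hκ]; ring,
      by rw [hp, hκ]; ring, fun h => hvp ((hCu.dvd_mul_left).1 h)⟩
  have hpu := (hu.irreducible_of_one hu0).prime
  have hsp : s p = p := by
    have h1 := hss r
    rw [hru, map_mul, hsu] at h1
    exact mul_left_cancel₀ hu0 h1
  obtain ⟨w, hw, hbw⟩ := hl.exists_eq_mul_of_dvd (l := 1) (hb.sub ((hu.pow 2).C_mul κ))
    (hker _ (by rw [map_sub, map_mul, map_pow, hsC, hsu, hbu, sub_self]))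
  obtain ⟨m, hm⟩ : l ∣ r - u * p := hker _ (by rw [map_sub, map_mul, hsu, hsp, hru, sub_self])
  obtain ⟨w', hw'⟩ : l ∣ C κ * K - p ^ 2 := by
    refine hker _ ?_
    rw [map_sub, map_mul, map_pow, hsC, hsp]
    apply mul_left_cancel₀ (pow_ne_zero 2 hu0)
    rw [hru, hbu] at hsK
    linear_combination -hsK
  have hmain : 2 * C κ * (u * p * m) + C κ * l * (m ^ 2 - a) =
      C κ * u ^ 2 * w' + w * p ^ 2 + l * w * w' := by
    apply mul_left_cancel₀ hl0
    linear_combination C κ * hK + C κ * K * hbw - C κ * (r + u * p + l * m) * hm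
      + (C κ * u ^ 2 + l * w) * hw'
  have huw : u ∣ s w := by
    have h1 := congrArg s hmain
    simp only [map_add, map_sub, map_mul, map_pow, hs0, hsC, hsu, hsp, map_ofNat] at h1
    have h2 : u ∣ s w * p ^ 2 := ⟨2 * C κ * p * s m - C κ * u * s w', by linear_combination -h1⟩
    exact (hpu.dvd_or_dvd h2).resolve_right fun h => hup (hpu.dvd_of_dvd_pow h)
  obtain ⟨k, hk⟩ := hu.exists_eq_C_mul_of_dvd (hsh w 1 hw) huw
  obtain ⟨t, ht⟩ := hl.exists_eq_C_mul_of_dvd (hw.sub (hu.C_mul k))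
    (hker _ (by rw [map_sub, map_mul, hsC, hsu, hk, sub_self]))
  obtain ⟨c, d, hc, hd, hcd⟩ := exists_eq_mul_of_binary hu hl κ k t
  exact hbsplit c d hc hd (by linear_combination hcd + hbw + l * ht)

/-- A pencil of symmetric bilinear forms with nonzero second member contains a member whose kernel
is not contained in the kernel of the pencil. -/
lemma exists_kernel_of_symm_pencil {V : Type*} [AddCommGroup V] [Module ℂ V]
    [FiniteDimensional ℂ V] (MA MB : V →ₗ[ℂ] Module.Dual ℂ V)
    (hA : ∀ v w, MA v w = MA w v) (hB : ∀ v w, MB v w = MB w v) (hB0 : MB ≠ 0) :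
    (∃ p, MB p = 0 ∧ MA p ≠ 0) ∨ ∃ (t : ℂ) (p : V), MA p = t • MB p ∧ MB p ≠ 0 := by
  refine or_iff_not_imp_left.2 fun hne => ?_
  push Not at hne
  have hrange : ∀ v, ∃ w, MB w = MA v := by
    intro v
    have h1 : MA v ∈ MB.ker.dualAnnihilator := by
      rw [Submodule.mem_dualAnnihilator]
      intro w hw
      rw [hA, hne w hw, LinearMap.zero_apply]
    rw [← LinearMap.range_dualMap_eq_dualAnnihilator_ker] at h1
    obtain ⟨φ, hφ⟩ := h1
    obtain ⟨w, rfl⟩ := (Module.evalEquiv ℂ V).surjective φ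
    refine ⟨w, LinearMap.ext fun u => ?_⟩
    rw [← hφ, hB]
    simp
  let MA' : (V ⧸ MB.ker) →ₗ[ℂ] MB.range :=
    MB.ker.liftQ (MA.codRestrict MB.range hrange) fun w hw => by
      exact Subtype.ext (hne w hw)
  let T : Module.End ℂ (V ⧸ MB.ker) := MB.quotKerEquivRange.symm.toLinearMap ∘ₗ MA'
  have : Nontrivial (V ⧸ MB.ker) := by
    rw [Submodule.Quotient.nontrivial_iff]
    simpa [LinearMap.ker_eq_top] using hB0
  obtain ⟨t, ht⟩ := Module.End.exists_eigenvalue T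
  obtain ⟨y, hy⟩ := ht.exists_hasEigenvector
  obtain ⟨p, rfl⟩ := Submodule.Quotient.mk_surjective _ y
  refine ⟨t, p, ?_, fun h => hy.2 ((Submodule.Quotient.mk_eq_zero _).2 h)⟩
  have h1 := congrArg (fun y => (MB.quotKerEquivRange y : Module.Dual ℂ V)) hy.apply_eq_smul
  rw [map_smul] at h1
  simp only [T, LinearMap.comp_apply, LinearEquiv.coe_coe, LinearEquiv.apply_symm_apply] at h1
  exact h1

/-- Induction principle: a homogeneous quadratic is a sum of products of two linear forms. -/
@[elab_as_elim]
lemma IsHomogeneous.induction_two {motive : MvPolynomial σ ℂ → Prop} {f : MvPolynomial σ ℂ}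
    (hf : f.IsHomogeneous 2)
    (hmul : ∀ c d : MvPolynomial σ ℂ, c.IsHomogeneous 1 → d.IsHomogeneous 1 → motive (c * d))
    (hadd : ∀ f g, motive f → motive g → motive (f + g)) : motive f := by
  have h : f ∈ homogeneousSubmodule σ ℂ 2 := hf
  rw [← homogeneousSubmodule_one_pow, pow_two] at h
  exact Submodule.mul_induction_on h (fun c hc d hd => hmul c d hc hd) hadd

/-- The linear functional defined by a linear form. -/
lemma IsHomogeneous.exists_dual [Fintype σ] {f : MvPolynomial σ ℂ} (hf : f.IsHomogeneous 1) :
    ∃ φ : Module.Dual ℂ (σ → ℂ), ∀ v, eval v f = φ v := by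
  obtain ⟨a, rfl⟩ := hf.eq_sum_of_one
  refine ⟨∑ i, a i • LinearMap.proj i, fun v => ?_⟩
  simp [map_sum]

/-- The symmetric bilinear form of a homogeneous quadratic. -/
lemma IsHomogeneous.exists_bilin [Fintype σ] {f : MvPolynomial σ ℂ} (hf : f.IsHomogeneous 2) :
    ∃ M : (σ → ℂ) →ₗ[ℂ] Module.Dual ℂ (σ → ℂ), (∀ v w, M v w = M w v) ∧
      ∀ v, eval v f = M v v := by
  refine IsHomogeneous.induction_two hf (fun c d hc hd => ?_) fun f g => ?_
  · obtain ⟨φ, hφ⟩ := hc.exists_dual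
    obtain ⟨ψ, hψ⟩ := hd.exists_dual
    refine ⟨(2⁻¹ : ℂ) • (φ.smulRight ψ + ψ.smulRight φ), fun v w => ?_, fun v => ?_⟩
    · simp; ring
    · simp [hφ, hψ]; ring
  · rintro ⟨M, hM, hMf⟩ ⟨N, hN, hNg⟩
    exact ⟨M + N, fun v w => by simp [hM v w, hN v w], fun v => by simp [hMf, hNg]⟩

/-- `f` is invariant under translation by multiples of `p`. -/
def InvariantAlong (p : σ → ℂ) (f : MvPolynomial σ ℂ) : Prop :=
  ∀ (v : σ → ℂ) (t : ℂ), eval (v + t • p) f = eval v f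

lemma IsHomogeneous.eval_add_smul [Fintype σ] {f : MvPolynomial σ ℂ} (hf : f.IsHomogeneous 1)
    (v p : σ → ℂ) (t : ℂ) : eval (v + t • p) f = eval v f + t * eval p f := by
  obtain ⟨φ, hφ⟩ := hf.exists_dual
  simp [hφ]

/-- Expansion of a homogeneous quadratic in powers of a linear form `x` with `x(p) = 1`. -/
lemma IsHomogeneous.exists_expansion [Fintype σ] {p : σ → ℂ} {x f : MvPolynomial σ ℂ}
    (hx : x.IsHomogeneous 1) (hxp : eval p x = 1) (hf : f.IsHomogeneous 2) :
    ∃ (q : ℂ) (l r : MvPolynomial σ ℂ), l.IsHomogeneous 1 ∧ r.IsHomogeneous 2 ∧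
      InvariantAlong p l ∧ InvariantAlong p r ∧ f = C q * x ^ 2 + x * l + r := by
  refine IsHomogeneous.induction_two hf (fun c d hc hd => ?_) fun f g => ?_
  · have key : ∀ c : MvPolynomial σ ℂ, c.IsHomogeneous 1 → ∃ (q : ℂ) (l : MvPolynomial σ ℂ),
        l.IsHomogeneous 1 ∧ InvariantAlong p l ∧ c = C q * x + l := by
      intro c hc
      refine ⟨eval p c, c - C (eval p c) * x, hc.sub (hx.C_mul _), fun v t => ?_, by ring⟩
      simp only [map_sub, map_mul, eval_C, hc.eval_add_smul, hx.eval_add_smul, hxp]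
      ring
    obtain ⟨q, l, hl, hlp, rfl⟩ := key c hc
    obtain ⟨q', l', hl', hlp', rfl⟩ := key d hd
    refine ⟨q * q', C q * l' + C q' * l, l * l', (hl'.C_mul _).add (hl.C_mul _), hl.mul hl',
      fun v t => ?_, fun v t => ?_, ?_⟩
    · simp [hlp v t, hlp' v t]
    · simp [hlp v t, hlp' v t]
    · rw [MvPolynomial.C_mul]
      ring
  · rintro ⟨q, l, r, hl, hr, hlp, hrp, rfl⟩ ⟨q', l', r', hl', hr', hlp', hrp', rfl⟩
    refine ⟨q + q', l + l', r + r', hl.add hl', hr.add hr', fun v t => ?_, fun v t => ?_, ?_⟩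
    · simp [hlp v t, hlp' v t]
    · simp [hrp v t, hrp' v t]
    · rw [C_add]
      ring

/-- The main case: `b` is invariant along a direction `p` along which `A` is not. -/
lemma exists_eq_add_of_invariantAlong [Fintype σ] {K : Type*} [Fintype K]
    {Q : K → MvPolynomial σ ℂ} {A b : MvPolynomial σ ℂ} {p : σ → ℂ}
    (hQ : ∀ k, (Q k).IsHomogeneous 2) (hA : A.IsHomogeneous 2) (hb : b.IsHomogeneous 2)
    (hbp : InvariantAlong p b) (hAp : ¬ InvariantAlong p A)
    (hbsplit : ∀ c d : MvPolynomial σ ℂ, c.IsHomogeneous 1 → d.IsHomogeneous 1 → b ≠ c * d)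
    (hsplit : ∀ t : ℂ, ∀ c d : MvPolynomial σ ℂ, c.IsHomogeneous 1 → d.IsHomogeneous 1 →
      A + C t * b ≠ c * d)
    (hlin : ∀ c d : MvPolynomial σ ℂ, c.IsHomogeneous 1 → d.IsHomogeneous 1 →
      A ∈ Ideal.span {c, d} → b ∉ Ideal.span {c, d})
    (hvan : ∀ v, eval v A = 0 → eval v b = 0 → ∃ k, eval v (Q k) = 0) :
    ∃ k, ∃ μ ν : ℂ, Q k = C μ * A + C ν * b := by
  have hbirr : Irreducible b := hb.irreducible_or_exists_eq_mul.resolve_right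
    fun ⟨c, d, hc, hd, h⟩ => hbsplit c d hc hd h
  obtain ⟨i, hi⟩ : ∃ i, p i ≠ 0 := by
    by_contra! h
    obtain rfl : p = 0 := _root_.funext h
    exact hAp fun v t => by simp
  obtain ⟨x, hx, hxp⟩ : ∃ x : MvPolynomial σ ℂ, x.IsHomogeneous 1 ∧ eval p x = 1 :=
    ⟨C (p i)⁻¹ * X i, isHomogeneous_C_mul_X _ _, by simp [hi]⟩
  obtain ⟨q, a₁, a₀, ha₁, ha₀, ha₁p, ha₀p, rfl⟩ := hx.exists_expansion hxp hA
  by_cases hq : q = 0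
  · subst hq
    rw [C_0, zero_mul, zero_add] at *
    have ha₁0 : a₁ ≠ 0 := by
      rintro rfl
      exact hAp (by simpa using ha₀p)
    choose q l r hl hr hlp hrp hQe using fun k => hx.exists_expansion hxp (hQ k)
    have hdvd : b ∣ a₁ * ∏ k, (C (q k) * a₀ ^ 2 - a₀ * a₁ * l k + a₁ ^ 2 * r k) := by
      refine dvd_of_forall_eval_eq_zero hbirr fun v hv => ?_
      by_cases h1 : eval v a₁ = 0
      · simp [h1]
      obtain ⟨t, ht⟩ : ∃ t, eval (v + t • p) x = - eval v a₀ / eval v a₁ :=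
        ⟨- eval v a₀ / eval v a₁ - eval v x, by rw [hx.eval_add_smul, hxp]; ring⟩
      obtain ⟨k, hk⟩ := hvan (v + t • p)
        (by rw [map_add, map_mul, ht, ha₁p, ha₀p]; field_simp; ring) (by rw [hbp, hv])
      rw [map_mul, map_prod, Finset.prod_eq_zero (Finset.mem_univ k), mul_zero]
      rw [hQe] at hk
      simp only [map_add, map_mul, map_pow, eval_C, ht, hlp k v t, hrp k v t] at hk
      simp only [map_add, map_sub, map_mul, map_pow, eval_C]
      field_simp at hk
      linear_combination hk
    obtain ⟨k, -, hk⟩ := (hbirr.prime.dvd_finsetProd_iff _).1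
      ((hbirr.prime.dvd_or_dvd hdvd).resolve_left
        fun h => ha₁0 (hb.eq_zero_of_dvd_of_lt ha₁ one_lt_two h))
    refine ⟨k, ?_⟩
    rw [hQe k]
    exact exists_eq_add_of_dvd_resultant_linear hx ha₁ ha₁0 ha₀ hb hbirr (hl k) (hr k) hsplit hlin
      hk
  · -- complete the square
    obtain ⟨z, hz⟩ : ∃ z, z = x + C (1 / (2 * q)) * a₁ := ⟨_, rfl⟩
    obtain ⟨a, ha⟩ : ∃ a, a = C (1 / (2 * q)) ^ 2 * a₁ ^ 2 - C (1 / q) * a₀ := ⟨_, rfl⟩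
    have hzh : z.IsHomogeneous 1 := hz ▸ hx.add (ha₁.C_mul _)
    have hah : a.IsHomogeneous 2 := by
      rw [ha, ← C_pow]
      exact ((ha₁.pow 2).C_mul _).sub (ha₀.C_mul _)
    have hap : InvariantAlong p a := fun v t => by simp [ha, ha₁p v t, ha₀p v t]
    have hzp : eval p z = 1 := by
      have h1 := ha₁p 0 1
      rw [ha₁.eval_add_smul] at h1
      have h2 : eval p a₁ = 0 := by simpa using h1
      simp [hz, hxp, h2]
    have hAz : C q * x ^ 2 + x * a₁ + a₀ = C q * (z ^ 2 - a) := by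
      have h1 : C q * C (1 / q) = (1 : MvPolynomial σ ℂ) := by
        rw [← C_mul, mul_one_div_cancel hq, C_1]
      have h2 : C q * C (1 / (2 * q)) * 2 = (1 : MvPolynomial σ ℂ) := by
        rw [← map_ofNat (C : ℂ →+* MvPolynomial σ ℂ) 2, ← C_mul, ← C_mul, ← C_1]
        congr 1
        field_simp
      rw [hz, ha]
      linear_combination (-x * a₁) * h2 - a₀ * h1
    rw [hAz] at hsplit hvan ⊢
    choose e l r hl hr hlp hrp hQe using fun k => hzh.exists_expansion hzp (hQ k)
    have hdvd : b ∣ ∏ k, ((r k + C (e k) * a) ^ 2 - a * l k ^ 2) := by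
      refine dvd_of_forall_eval_eq_zero hbirr fun v hv => ?_
      obtain ⟨y, hy⟩ := IsAlgClosed.exists_pow_nat_eq (eval v a) two_pos
      obtain ⟨t, ht⟩ : ∃ t, eval (v + t • p) z = y :=
        ⟨y - eval v z, by rw [hzh.eval_add_smul, hzp]; ring⟩
      obtain ⟨k, hk⟩ := hvan (v + t • p)
        (by simp only [map_mul, map_sub, map_pow, ht, hap v t, hy, sub_self, mul_zero])
        (by rw [hbp, hv])
      rw [map_prod, Finset.prod_eq_zero (Finset.mem_univ k)]
      rw [hQe] at hk
      simp only [map_add, map_mul, map_pow, eval_C, ht, hlp k v t, hrp k v t] at hk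
      simp only [map_add, map_sub, map_mul, map_pow, eval_C]
      rw [← hy]
      linear_combination (eval v (r k) + e k * y ^ 2 - y * eval v (l k)) * hk
    obtain ⟨k, -, hk⟩ := (hbirr.prime.dvd_finsetProd_iff _).1 hdvd
    have hCu : C q * C q⁻¹ = (1 : MvPolynomial σ ℂ) := by
      rw [← C_mul, mul_inv_cancel₀ hq, C_1]
    obtain ⟨μ, ν, h⟩ := exists_eq_add_of_dvd_resultant_square hzh hah hb hbsplit (hl k) (hr k)
      (fun t c d hc hd h => hsplit (q * t) (C q * c) d (hc.C_mul q) hd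
        (by rw [C_mul]; linear_combination C q * h)) hk
    refine ⟨k, μ * q⁻¹, ν, ?_⟩
    rw [hQe k, h, C_mul]
    linear_combination (-C μ * (z ^ 2 - a)) * hCu

lemma InvariantAlong.of_bilin {f : MvPolynomial σ ℂ} {p : σ → ℂ}
    {M : (σ → ℂ) →ₗ[ℂ] Module.Dual ℂ (σ → ℂ)} (hM : ∀ v w, M v w = M w v)
    (hf : ∀ v, eval v f = M v v) (hp : M p = 0) : InvariantAlong p f := fun v t => by
  simp [hf, hM v p, hp]

lemma InvariantAlong.bilin_eq_zero {f : MvPolynomial σ ℂ} {p : σ → ℂ}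
    {M : (σ → ℂ) →ₗ[ℂ] Module.Dual ℂ (σ → ℂ)} (hM : ∀ v w, M v w = M w v)
    (hf : ∀ v, eval v f = M v v) (hp : InvariantAlong p f) : M p = 0 := by
  refine LinearMap.ext fun v => ?_
  have h1 := hp v 1
  have h2 := hp v (-1)
  simp only [hf, map_add, map_smul, LinearMap.add_apply, LinearMap.smul_apply, smul_eq_mul,
    hM v p] at h1 h2
  rw [LinearMap.zero_apply]
  linear_combination (h1 - h2) / 4

end MvPolynomial

/-- structure theorem. If a product of homogeneous quadratics
`∏ k, Q k` lies in `√⟨A,B⟩` for homogeneous quadratics `A, B`, then either some `Q k`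
is in the linear span of `A` and `B`, or some nontrivial linear combination of `A` and `B`
is a product of two linear forms, or there are linear forms `c, d` such that
`A`, `B` and some `Q k` all lie in the ideal `⟨c,d⟩`. -/
theorem statement1 {n : ℕ} (K : Type) [Fintype K]
    (Q : K → MvPolynomial (Fin n) ℂ) (A B : MvPolynomial (Fin n) ℂ)
    (hQ : ∀ k, (Q k).IsHomogeneous 2)
    (hA : A.IsHomogeneous 2) (hB : B.IsHomogeneous 2)
    (hrad : (∏ k, Q k) ∈ (Ideal.span {A, B}).radical) :
    (∃ k, Q k ∈ Submodule.span ℂ {A, B}) ∨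
    (∃ α β : ℂ, ¬(α = 0 ∧ β = 0) ∧
      ∃ c d : MvPolynomial (Fin n) ℂ, c.IsHomogeneous 1 ∧ d.IsHomogeneous 1 ∧
        α • A + β • B = c * d) ∨
    (∃ c d : MvPolynomial (Fin n) ℂ, c.IsHomogeneous 1 ∧ d.IsHomogeneous 1 ∧
      A ∈ Ideal.span {c, d} ∧ B ∈ Ideal.span {c, d} ∧ ∃ k, Q k ∈ Ideal.span {c, d}) := by
  by_contra! hcon
  obtain ⟨hspan, hsplit, hlin⟩ := hcon
  have hsplit' : ∀ α β : ℂ, ¬(α = 0 ∧ β = 0) → ∀ c d : MvPolynomial (Fin n) ℂ,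
      c.IsHomogeneous 1 → d.IsHomogeneous 1 → C α * A + C β * B ≠ c * d := by
    intro α β h c d hc hd
    simpa only [smul_eq_C_mul] using hsplit α β (fun h1 h2 => h ⟨h1, h2⟩) c d hc hd
  have hspan' : ∀ (k : K) (μ ν : ℂ), Q k ≠ C μ * A + C ν * B := fun k μ ν h =>
    hspan k (Submodule.mem_span_pair.2 ⟨μ, ν, by simp only [h, smul_eq_C_mul]⟩)
  have hlin' : ∀ c d : MvPolynomial (Fin n) ℂ, c.IsHomogeneous 1 → d.IsHomogeneous 1 →
      A ∈ Ideal.span {c, d} → B ∉ Ideal.span {c, d} := by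
    intro c d hc hd hAm hBm
    have hprime := isPrime_span_pair_of_isHomogeneous_one hc hd
    have hle : Ideal.span {A, B} ≤ Ideal.span {c, d} := by
      rw [Ideal.span_le]
      rintro y (rfl | rfl) <;> assumption
    obtain ⟨k, -, hk⟩ := hprime.prod_mem_iff.1 (hprime.radical_le_iff.2 hle hrad)
    exact hlin c d hc hd hAm hBm k hk
  have hvan : ∀ v, eval v A = 0 → eval v B = 0 → ∃ k, eval v (Q k) = 0 := by
    intro v hAv hBv
    have hle : Ideal.span {A, B} ≤ RingHom.ker (eval v) := by
      rw [Ideal.span_le]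
      rintro y (rfl | rfl) <;> assumption
    obtain ⟨k, -, hk⟩ := (RingHom.ker_isPrime (eval v)).prod_mem_iff.1
      ((RingHom.ker_isPrime (eval v)).radical_le_iff.2 hle hrad)
    exact ⟨k, hk⟩
  obtain ⟨MA, hMA, hMAe⟩ := hA.exists_bilin
  obtain ⟨MB, hMB, hMBe⟩ := hB.exists_bilin
  have hMB0 : MB ≠ 0 := by
    rintro rfl
    have hB0 : B = 0 := MvPolynomial.funext fun v => by simp [hMBe]
    exact hsplit' 0 1 (by simp) 0 0 (isHomogeneous_zero _ _ _) (isHomogeneous_zero _ _ _)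
      (by simp [hB0])
  obtain ⟨p, hBp, hAp⟩ | ⟨t, p, hAp, hBp⟩ := exists_kernel_of_symm_pencil MA MB hMA hMB hMB0
  · obtain ⟨k, μ, ν, h⟩ := exists_eq_add_of_invariantAlong hQ hA hB (.of_bilin hMB hMBe hBp)
      (fun h => hAp (h.bilin_eq_zero hMA hMAe))
      (fun c d hc hd h => hsplit' 0 1 (by simp) c d hc hd (by simpa using h))
      (fun t c d hc hd h => hsplit' 1 t (by simp) c d hc hd (by simpa using h)) hlin' hvan
    exact hspan' k μ ν h
  · have hinv : InvariantAlong p (A - C t * B) := by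
      refine .of_bilin (M := MA - t • MB) (fun v w => ?_) (fun v => ?_) ?_
      · simp [hMA v w, hMB v w]
      · simp [hMAe, hMBe]
      · simp [hAp]
    obtain ⟨k, μ, ν, h⟩ := exists_eq_add_of_invariantAlong hQ hB (hA.sub (hB.C_mul t)) hinv
      (fun h => hBp (h.bilin_eq_zero hMB hMBe))
      (fun c d hc hd h => hsplit' 1 (-t) (by simp) c d hc hd
        (by rw [← h, C_1, C_neg]; ring))
      (fun s c d hc hd h => hsplit' s (1 - s * t)
        (by rintro ⟨rfl, h⟩; simp at h) c d hc hd
        (by rw [← h, C_sub, C_1, C_mul]; ring))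
      (fun c d hc hd hBm hm => hlin' c d hc hd
        (by simpa using add_mem hm (Ideal.mul_mem_left _ (C t) hBm)) hBm)
      (fun v hBv hv => hvan v (by simpa [hBv] using hv) hBv)
    refine hspan' k ν (μ - ν * t) ?_
    rw [h, C_sub, C_mul]
    ring
end

section
/- Let Q ∈ ℂ[x₁,…,xₙ] be a homogeneous quadratic with rank_s(Q) = r, and suppose Q = Σ_{i=1}^r a_{2i−1}·a_{2i} and Q = Σ_{i=1}^r b_{2i−1}·b_{2i} are two minimal representations of Q by linear forms. Then span_ℂ{a₁,…,a_{2r}} = span_ℂ{b₁,…,b_{2r}}. -/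
open MvPolynomial

/-- `rankS Q` is the minimal `r` such that `Q = ∑_{i=1}^r a_i · b_i` for linear forms
`a_i, b_i`. -/
noncomputable def rankS {σ : Type*} (Q : MvPolynomial σ ℂ) : ℕ :=
  sInf {r : ℕ | ∃ a b : Fin r → MvPolynomial σ ℂ,
    (∀ i, (a i).IsHomogeneous 1) ∧ (∀ i, (b i).IsHomogeneous 1) ∧ Q = ∑ i, a i * b i}

/-- The linear form on `ℂⁿ`, as a polynomial, attached to a linear functional. -/
noncomputable def linForm (n : ℕ) :
    Module.Dual ℂ (Fin n → ℂ) →ₗ[ℂ] MvPolynomial (Fin n) ℂ where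
  toFun φ := ∑ j, φ (Pi.single j 1) • X j
  map_add' φ ψ := by simp [add_smul, Finset.sum_add_distrib]
  map_smul' c φ := by simp [mul_smul, Finset.smul_sum]

theorem linForm_apply {n : ℕ} (φ : Module.Dual ℂ (Fin n → ℂ)) :
    linForm n φ = ∑ j, φ (Pi.single j 1) • X j := rfl

theorem dual_apply_eq_sum {n : ℕ} (φ : Module.Dual ℂ (Fin n → ℂ)) (v : Fin n → ℂ) :
    φ v = ∑ j, φ (Pi.single j 1) * v j := by
  conv_lhs => rw [← Finset.univ_sum_single v, map_sum]
  refine Finset.sum_congr rfl fun j _ => ?_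
  rw [show (Pi.single j (v j) : Fin n → ℂ) = v j • Pi.single j 1 by
    rw [← Pi.single_smul, smul_eq_mul, mul_one], map_smul, smul_eq_mul, mul_comm]

theorem eval_linForm {n : ℕ} (φ : Module.Dual ℂ (Fin n → ℂ)) (v : Fin n → ℂ) :
    eval v (linForm n φ) = φ v := by
  rw [dual_apply_eq_sum φ v, linForm_apply]
  simp [smul_eval]

theorem linForm_injective (n : ℕ) : Function.Injective (linForm n) := fun φ ψ h =>
  LinearMap.ext fun v => by rw [← eval_linForm φ v, h, eval_linForm]

theorem linForm_isHomogeneous {n : ℕ} (φ : Module.Dual ℂ (Fin n → ℂ)) :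
    (linForm n φ).IsHomogeneous 1 := by
  rw [linForm_apply, ← mem_homogeneousSubmodule]
  exact Submodule.sum_mem _ fun j _ => Submodule.smul_mem _ _ (isHomogeneous_X ℂ j)

theorem exists_linForm_eq {n : ℕ} {p : MvPolynomial (Fin n) ℂ} (hp : p.IsHomogeneous 1) :
    ∃ φ, linForm n φ = p := by
  rw [← mem_homogeneousSubmodule, homogeneousSubmodule_one_eq_span_X,
    Submodule.mem_span_range_iff_exists_fun] at hp
  obtain ⟨c, rfl⟩ := hp
  refine ⟨∑ j, c j • LinearMap.proj j, ?_⟩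
  rw [linForm_apply]
  refine Finset.sum_congr rfl fun j _ => ?_
  simp [Pi.single_apply]

/-- The derivative of a polynomial in the constant direction `v`. -/
noncomputable def dirDeriv {n : ℕ} (v : Fin n → ℂ) :
    Derivation ℂ (MvPolynomial (Fin n) ℂ) (MvPolynomial (Fin n) ℂ) :=
  mkDerivation ℂ fun j => C (v j)

theorem dirDeriv_linForm {n : ℕ} (v : Fin n → ℂ) (φ : Module.Dual ℂ (Fin n → ℂ)) :
    dirDeriv v (linForm n φ) = C (φ v) := by
  rw [dual_apply_eq_sum φ v, linForm_apply]
  simp [dirDeriv, mkDerivation_X, smul_eq_C_mul]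

theorem dirDeriv_sum_mul {n : ℕ} {ι : Type*} [Fintype ι] (v : Fin n → ℂ)
    (α β : ι → Module.Dual ℂ (Fin n → ℂ)) :
    dirDeriv v (∑ i, linForm n (α i) * linForm n (β i)) =
      ∑ i, (α i v • linForm n (β i) + β i v • linForm n (α i)) := by
  rw [map_sum]
  refine Finset.sum_congr rfl fun i _ => ?_
  rw [Derivation.leibniz, dirDeriv_linForm, dirDeriv_linForm]
  simp only [smul_eq_C_mul, smul_eq_mul]
  ring

theorem LinearIndependent.exists_dual_vector {n : ℕ} {κ : Type*} [DecidableEq κ]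
    {f : κ → Module.Dual ℂ (Fin n → ℂ)} (hf : LinearIndependent ℂ f) (k : κ) :
    ∃ v, ∀ i, f i v = if i = k then 1 else 0 := by
  obtain ⟨g, hg⟩ := LinearMap.exists_leftInverse_of_injective _
    (LinearMap.ker_eq_bot.mpr hf)
  refine ⟨(Module.evalEquiv ℂ (Fin n → ℂ)).symm (Finsupp.lapply k ∘ₗ g), fun i => ?_⟩
  rw [Module.apply_evalEquiv_symm_apply]
  have := LinearMap.congr_fun hg (Finsupp.single i 1)
  simp only [LinearMap.comp_apply, Finsupp.linearCombination_single, one_smul,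
    LinearMap.id_apply] at this
  simp [this, Finsupp.single_apply]

/-- The space of all first-order directional derivatives of a polynomial. -/
noncomputable def derivSpan {n : ℕ} (Q : MvPolynomial (Fin n) ℂ) :
    Submodule ℂ (MvPolynomial (Fin n) ℂ) :=
  Submodule.span ℂ (Set.range fun v => dirDeriv v Q)

theorem dirDeriv_mem_derivSpan {n : ℕ} (v : Fin n → ℂ) (Q : MvPolynomial (Fin n) ℂ) :
    dirDeriv v Q ∈ derivSpan Q :=
  Submodule.subset_span ⟨v, rfl⟩

theorem exists_sum_mul_of_sum_sq {σ : Type*} : ∀ (m : ℕ) (u : Fin m → MvPolynomial σ ℂ),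
    (∀ i, (u i).IsHomogeneous 1) →
    ∃ a b : Fin ((m + 1) / 2) → MvPolynomial σ ℂ, (∀ i, (a i).IsHomogeneous 1) ∧
      (∀ i, (b i).IsHomogeneous 1) ∧ ∑ i, u i * u i = ∑ i, a i * b i
  | 0, _, _ => ⟨fun _ => 0, fun _ => 0, fun _ => isHomogeneous_zero _ _ _,
      fun _ => isHomogeneous_zero _ _ _, by simp⟩
  | 1, u, hu => ⟨fun _ => u 0, fun _ => u 0, fun _ => hu 0, fun _ => hu 0, by simp⟩
  | m + 2, u, hu => by
    obtain ⟨a, b, ha, hb, h⟩ := exists_sum_mul_of_sum_sq m (fun i => u i.succ.succ)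
      fun i => hu _
    rw [show (m + 2 + 1) / 2 = (m + 1) / 2 + 1 by omega]
    have hI : (C Complex.I * u 1).IsHomogeneous 1 := by
      simpa using (isHomogeneous_C _ Complex.I).mul (hu 1)
    refine ⟨Fin.cons (u 0 + C Complex.I * u 1) a, Fin.cons (u 0 - C Complex.I * u 1) b,
      Fin.cases ((hu 0).add hI) ha, Fin.cases ((hu 0).sub hI) hb, ?_⟩
    have hC : (C Complex.I * C Complex.I : MvPolynomial σ ℂ) = -1 := by
      rw [← C_mul, Complex.I_mul_I, C_neg, C_1]
    simp only [Fin.sum_univ_succ (n := m + 1), Fin.sum_univ_succ (n := m),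
      Fin.sum_univ_succ (n := (m + 1) / 2), Fin.cons_zero, Fin.cons_succ, h, Fin.succ_zero_eq_one]
    linear_combination (u 1 * u 1) * hC

theorem rankS_sum_sq_le {σ ι : Type*} [Fintype ι] (u : ι → MvPolynomial σ ℂ)
    (hu : ∀ i, (u i).IsHomogeneous 1) :
    rankS (∑ i, u i * u i) ≤ (Fintype.card ι + 1) / 2 := by
  obtain ⟨a, b, ha, hb, h⟩ := exists_sum_mul_of_sum_sq (Fintype.card ι)
    (u ∘ (Fintype.equivFin ι).symm) fun i => hu _
  refine Nat.sInf_le ⟨a, b, ha, hb, h ▸ ?_⟩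
  exact (Equiv.sum_comp (Fintype.equivFin ι).symm fun i => u i * u i).symm

/-- A quadratic is a sum of squares of linearly independent linear forms. -/
theorem exists_sum_sq_linearIndependent {n r : ℕ} (α β : Fin r → Module.Dual ℂ (Fin n → ℂ)) :
    ∃ (d : ℕ) (u : Fin d → Module.Dual ℂ (Fin n → ℂ)), LinearIndependent ℂ u ∧
      ∑ i, linForm n (α i) * linForm n (β i) = ∑ i, linForm n (u i) * linForm n (u i) := by
  classical
  let q : QuadraticForm ℂ (Fin n → ℂ) := ∑ i, QuadraticMap.linMulLin (α i) (β i)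
  obtain ⟨w, ⟨e⟩⟩ := QuadraticForm.equivalent_weightedSumSquares q
  choose s hs using fun i => IsAlgClosed.exists_pow_nat_eq (w i) two_pos
  let l : Fin (Module.finrank ℂ (Fin n → ℂ)) → Module.Dual ℂ (Fin n → ℂ) := fun i =>
    LinearMap.proj i ∘ₗ e.toLinearEquiv.toLinearMap
  have hl : LinearIndependent ℂ l := by
    rw [Fintype.linearIndependent_iff]
    intro c hc i
    have := LinearMap.congr_fun hc (e.toLinearEquiv.symm (Pi.single i 1))
    simpa [l, Pi.single_apply] using this
  let κ := {i // s i ≠ 0}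
  let t : κ → Module.Dual ℂ (Fin n → ℂ) := fun i => s i • l i
  have ht : LinearIndependent ℂ t :=
    (hl.comp _ Subtype.val_injective).units_smul fun i : κ => Units.mk0 (s i) i.2
  have hQ : ∑ i, linForm n (α i) * linForm n (β i) =
      ∑ i : κ, linForm n (t i) * linForm n (t i) := by
    refine MvPolynomial.funext fun v => ?_
    have hv : q v = ∑ i, w i * (l i v * l i v) := by
      rw [← e.map_app v, QuadraticMap.weightedSumSquares_apply]
      rfl
    have hq : q v = ∑ i, α i v * β i v := by simp [q]
    simp only [map_sum, map_mul, eval_linForm]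
    rw [← hq, hv]
    refine (Fintype.sum_of_injective (Subtype.val : κ → _) Subtype.val_injective _ _
      (fun i hi => ?_) fun i => ?_).symm
    · have : s i = 0 := by simpa [κ] using hi
      simp [← hs, this]
    · simp only [t, LinearMap.smul_apply, smul_eq_mul, ← hs]
      ring
  refine ⟨Fintype.card κ, t ∘ (Fintype.equivFin κ).symm, ht.comp _ (Equiv.injective _), ?_⟩
  rw [hQ]
  exact (Equiv.sum_comp (Fintype.equivFin κ).symm fun i => linForm n (t i) * linForm n (t i)).symm

/-- A minimal representation of a quadratic spans the space of its directional derivatives. -/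
theorem span_eq_derivSpan {n r : ℕ} (α β : Fin r → Module.Dual ℂ (Fin n → ℂ))
    (hrank : rankS (∑ i, linForm n (α i) * linForm n (β i)) = r) :
    Submodule.span ℂ (Set.range (linForm n ∘ α) ∪ Set.range (linForm n ∘ β)) =
      derivSpan (∑ i, linForm n (α i) * linForm n (β i)) := by
  classical
  obtain ⟨d, u, hu, hQ⟩ := exists_sum_sq_linearIndependent α β
  set Q := ∑ i, linForm n (α i) * linForm n (β i) with hQdef
  have hle : derivSpan Q ≤
      Submodule.span ℂ (Set.range (linForm n ∘ α) ∪ Set.range (linForm n ∘ β)) := by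
    refine Submodule.span_le.mpr ?_
    rintro _ ⟨v, rfl⟩
    simp only [hQdef, dirDeriv_sum_mul]
    exact Submodule.sum_mem _ fun i _ => Submodule.add_mem _
      (Submodule.smul_mem _ _ (Submodule.subset_span (Or.inr ⟨i, rfl⟩)))
      (Submodule.smul_mem _ _ (Submodule.subset_span (Or.inl ⟨i, rfl⟩)))
  have hrd : r ≤ (d + 1) / 2 := by
    rw [← hrank, hQ]
    simpa using rankS_sum_sq_le (fun i => linForm n (u i)) fun i => linForm_isHomogeneous _
  have hmem : Submodule.span ℂ (Set.range (linForm n ∘ u)) ≤ derivSpan Q := by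
    refine Submodule.span_le.mpr ?_
    rintro _ ⟨k, rfl⟩
    obtain ⟨v, hv⟩ := hu.exists_dual_vector k
    have h := dirDeriv_mem_derivSpan v Q
    rw [hQ, dirDeriv_sum_mul, ← hQ] at h
    simp only [hv, ite_smul, one_smul, zero_smul, Finset.sum_add_distrib, Finset.sum_ite_eq',
      Finset.mem_univ, if_true, ← two_smul ℂ (linForm n (u k))] at h
    exact (Submodule.smul_mem_iff _ two_ne_zero).mp h
  have hdim : d = Module.finrank ℂ (Submodule.span ℂ (Set.range (linForm n ∘ u))) := by
    rw [finrank_span_eq_card (hu.map' _ (LinearMap.ker_eq_bot.mpr (linForm_injective n))),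
      Fintype.card_fin]
  rw [← Set.Sum.elim_range, ← Sum.comp_elim] at hle ⊢
  have hfin : Module.Finite ℂ (Submodule.span ℂ (Set.range (linForm n ∘ Sum.elim α β))) :=
    Module.Finite.span_of_finite ℂ (Set.finite_range _)
  have hcard : Module.finrank ℂ (Submodule.span ℂ (Set.range (linForm n ∘ Sum.elim α β))) ≤
      2 * r := by
    refine (finrank_range_le_card (R := ℂ) (linForm n ∘ Sum.elim α β)).trans_eq ?_
    simp [two_mul]
  by_cases hind : LinearIndependent ℂ (Sum.elim α β)
  · refine le_antisymm (Submodule.span_le.mpr ?_) hle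
    rintro _ ⟨k | k, rfl⟩
    · obtain ⟨v, hv⟩ := hind.exists_dual_vector (Sum.inr k)
      have h := dirDeriv_mem_derivSpan v Q
      have h₁ := fun i => hv (Sum.inl i)
      have h₂ := fun i => hv (Sum.inr i)
      simp only [Sum.elim_inl, Sum.elim_inr, reduceCtorEq, if_false, Sum.inr.injEq] at h₁ h₂
      rw [hQdef, dirDeriv_sum_mul, ← hQdef] at h
      simpa [h₁, h₂, ite_smul] using h
    · obtain ⟨v, hv⟩ := hind.exists_dual_vector (Sum.inl k)
      have h := dirDeriv_mem_derivSpan v Q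
      have h₁ := fun i => hv (Sum.inl i)
      have h₂ := fun i => hv (Sum.inr i)
      simp only [Sum.elim_inl, Sum.elim_inr, reduceCtorEq, if_false, Sum.inl.injEq] at h₁ h₂
      rw [hQdef, dirDeriv_sum_mul, ← hQdef] at h
      simpa [h₁, h₂, ite_smul] using h
  · have hne : Module.finrank ℂ (Submodule.span ℂ (Set.range (linForm n ∘ Sum.elim α β))) ≠
        2 * r := fun h => hind <| LinearIndependent.of_comp (linForm n) <|
      linearIndependent_iff_card_eq_finrank_span.mpr <| by
        rw [Set.finrank, h]
        simp [two_mul]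
    refine le_antisymm ?_ hle
    rw [← Submodule.eq_of_le_of_finrank_le (hmem.trans hle) (by omega)]
    exact hmem

/-- Any two minimal representations of a homogeneous quadratic span the
same space of linear forms. -/
theorem statement2 {n r : ℕ} (Q : MvPolynomial (Fin n) ℂ) (hQ : Q.IsHomogeneous 2)
    (hrank : rankS Q = r)
    (a b a' b' : Fin r → MvPolynomial (Fin n) ℂ)
    (ha : ∀ i, (a i).IsHomogeneous 1) (hb : ∀ i, (b i).IsHomogeneous 1)
    (ha' : ∀ i, (a' i).IsHomogeneous 1) (hb' : ∀ i, (b' i).IsHomogeneous 1)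
    (hrep : Q = ∑ i, a i * b i) (hrep' : Q = ∑ i, a' i * b' i) :
    Submodule.span ℂ (Set.range a ∪ Set.range b)
      = Submodule.span ℂ (Set.range a' ∪ Set.range b') := by
  choose α hα using fun i => exists_linForm_eq (ha i)
  choose β hβ using fun i => exists_linForm_eq (hb i)
  choose α' hα' using fun i => exists_linForm_eq (ha' i)
  choose β' hβ' using fun i => exists_linForm_eq (hb' i)
  obtain rfl : linForm n ∘ α = a := funext hα
  obtain rfl : linForm n ∘ β = b := funext hβ
  obtain rfl : linForm n ∘ α' = a' := funext hα'
  obtain rfl : linForm n ∘ β' = b' := funext hβ'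
  simp only [Function.comp_apply] at hrep hrep'
  rw [span_eq_derivSpan α β (hrep ▸ hrank), span_eq_derivSpan α' β' (hrep' ▸ hrank), ← hrep,
    ← hrep']
end

section
/- Let P₁ ∈ ℂ[x₁,…,x_k] be a homogeneous quadratic, viewed inside ℂ[x₁,…,x_k,y₁,y₂] where y₁, y₂ are two additional variables, and let P₂ = y₁·y₂. Then rank_s(P₁ + P₂) = rank_s(P₁) + 1, and moreover y₁, y₂ ∈ MS(P₁ + P₂). -/
open MvPolynomial

/-- `MS Q` is the minimal space of `Q`: the span of the linear forms appearing in a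
minimal representation of `Q` (well-defined by Claim 2.3 of the paper; here formalized
as the infimum over all minimal representations). -/
noncomputable def MS {σ : Type*} (Q : MvPolynomial σ ℂ) : Submodule ℂ (MvPolynomial σ ℂ) :=
  sInf {V : Submodule ℂ (MvPolynomial σ ℂ) | ∃ a b : Fin (rankS Q) → MvPolynomial σ ℂ,
    (∀ i, (a i).IsHomogeneous 1) ∧ (∀ i, (b i).IsHomogeneous 1) ∧ Q = ∑ i, a i * b i ∧
    V = Submodule.span ℂ (Set.range a ∪ Set.range b)}

/-- `Q` is a sum of `r` products of two linear forms. -/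
def IsSumOfLinearProducts {σ : Type*} (r : ℕ) (Q : MvPolynomial σ ℂ) : Prop :=
  ∃ a b : Fin r → MvPolynomial σ ℂ,
    (∀ i, (a i).IsHomogeneous 1) ∧ (∀ i, (b i).IsHomogeneous 1) ∧ Q = ∑ i, a i * b i

lemma IsSumOfLinearProducts.rankS_le {σ : Type*} {r : ℕ} {Q : MvPolynomial σ ℂ}
    (h : IsSumOfLinearProducts r Q) : rankS Q ≤ r :=
  Nat.sInf_le h

lemma IsSumOfLinearProducts.rankS {σ : Type*} {r : ℕ} {Q : MvPolynomial σ ℂ}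
    (h : IsSumOfLinearProducts r Q) : IsSumOfLinearProducts (rankS Q) Q :=
  Nat.sInf_mem (s := {r | IsSumOfLinearProducts r Q}) ⟨r, h⟩

lemma IsSumOfLinearProducts.add_mul {σ : Type*} {r : ℕ} {Q f g : MvPolynomial σ ℂ}
    (h : IsSumOfLinearProducts r Q) (hf : f.IsHomogeneous 1) (hg : g.IsHomogeneous 1) :
    IsSumOfLinearProducts (r + 1) (Q + f * g) := by
  obtain ⟨a, b, ha, hb, rfl⟩ := h
  refine ⟨Fin.cons f a, Fin.cons g b, Fin.cases hf ha, Fin.cases hg hb, ?_⟩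
  simp [Fin.sum_univ_succ, add_comm]

lemma IsSumOfLinearProducts.rename {σ τ : Type*} {r : ℕ} {Q : MvPolynomial σ ℂ}
    (h : IsSumOfLinearProducts r Q) (f : σ → τ) :
    IsSumOfLinearProducts r (MvPolynomial.rename f Q) := by
  obtain ⟨a, b, ha, hb, rfl⟩ := h
  exact ⟨fun i => MvPolynomial.rename f (a i), fun i => MvPolynomial.rename f (b i),
    fun i => (ha i).rename_isHomogeneous, fun i => (hb i).rename_isHomogeneous, by simp⟩

/-- Euler's identity writes a quadratic in `k` variables as a sum of `k` products. -/
lemma isSumOfLinearProducts_of_isHomogeneous_two {k : ℕ} {P : MvPolynomial (Fin k) ℂ}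
    (hP : P.IsHomogeneous 2) : IsSumOfLinearProducts k P := by
  refine ⟨X, fun i => C (1 / 2) * pderiv i P, isHomogeneous_X ℂ,
    fun i => by simpa using hP.pderiv.C_mul (1 / 2 : ℂ), ?_⟩
  calc P = C (1 / 2) * (2 • P) := by
        rw [nsmul_eq_mul, ← mul_assoc, show ((2 : ℕ) : MvPolynomial (Fin k) ℂ) = C 2 from (map_ofNat C 2).symm,
          ← C_mul]
        norm_num
    _ = _ := by
        rw [← hP.sum_X_mul_pderiv, Finset.mul_sum]
        exact Finset.sum_congr rfl fun i _ => by ring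

lemma MvPolynomial.IsHomogeneous.exists_pderiv_eq_C {σ : Type*} {f : MvPolynomial σ ℂ}
    (hf : f.IsHomogeneous 1) (s : σ) : ∃ c : ℂ, pderiv s f = C c :=
  ⟨_, totalDegree_eq_zero_iff_eq_C.1 ((totalDegree_zero_iff_isHomogeneous _).2 hf.pderiv)⟩

lemma pderiv_inr_rename_inl {σ τ : Type*} (t : τ) (P : MvPolynomial σ ℂ) :
    pderiv (Sum.inr t : σ ⊕ τ) (rename Sum.inl P) = 0 := by
  classical
  refine pderiv_eq_zero_of_notMem_vars fun h => ?_
  simpa using vars_rename Sum.inl P h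

/-- The partial derivatives of a sum of products of linear forms lie in the span of the forms. -/
lemma pderiv_sum_mul_mem_span {σ ι : Type*} [Fintype ι] {a b : ι → MvPolynomial σ ℂ}
    (ha : ∀ i, (a i).IsHomogeneous 1) (hb : ∀ i, (b i).IsHomogeneous 1) (s : σ) :
    pderiv s (∑ i, a i * b i) ∈ Submodule.span ℂ (Set.range a ∪ Set.range b) := by
  rw [map_sum]
  refine Submodule.sum_mem _ fun i _ => ?_
  obtain ⟨c, hc⟩ := (ha i).exists_pderiv_eq_C s
  obtain ⟨d, hd⟩ := (hb i).exists_pderiv_eq_C s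
  rw [pderiv_mul, hc, hd, mul_comm (a i), ← smul_eq_C_mul, ← smul_eq_C_mul]
  exact add_mem (Submodule.smul_mem _ _ (Submodule.subset_span (.inr ⟨i, rfl⟩)))
    (Submodule.smul_mem _ _ (Submodule.subset_span (.inl ⟨i, rfl⟩)))

lemma pderiv_mem_MS {σ : Type*} (Q : MvPolynomial σ ℂ) (s : σ) : pderiv s Q ∈ MS Q := by
  refine Submodule.mem_sInf.2 ?_
  rintro _ ⟨a, b, ha, hb, hQ, rfl⟩
  have h := pderiv_sum_mul_mem_span ha hb s
  rwa [← hQ] at h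

/-- A linear form involving `y₁` vanishes under some linear substitution for `y₁` which fixes the
`x` variables and sends `y₂` to zero. -/
lemma exists_aeval_eq_zero {σ : Type*} [Fintype σ] {f : MvPolynomial (σ ⊕ Fin 2) ℂ}
    (hf : f.IsHomogeneous 1) (h : pderiv (Sum.inr 0) f ≠ 0) :
    ∃ φ : σ ⊕ Fin 2 → MvPolynomial (σ ⊕ Fin 2) ℂ, (∀ s, (φ s).IsHomogeneous 1) ∧
      (∀ j, φ (Sum.inl j) = X (Sum.inl j)) ∧ φ (Sum.inr 1) = 0 ∧ aeval φ f = 0 := by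
  choose c hc using hf.exists_pderiv_eq_C
  have hc0 : c (Sum.inr 0) ≠ 0 := fun h0 => h (by rw [hc, h0, C_0])
  let L : MvPolynomial (σ ⊕ Fin 2) ℂ := ∑ j, X (Sum.inl j) * C (c (Sum.inl j))
  have hL : L.IsHomogeneous 1 := IsHomogeneous.sum _ _ _ fun j _ => by
    simpa using (isHomogeneous_X ℂ _).mul (isHomogeneous_C _ (c (Sum.inl j)))
  refine ⟨Sum.elim (fun j => X (Sum.inl j)) ![C (-(c (Sum.inr 0))⁻¹) * L, 0], ?_,
    fun j => rfl, rfl, ?_⟩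
  · rintro (j | j)
    · exact isHomogeneous_X ℂ _
    · fin_cases j
      · exact hL.C_mul _
      · exact isHomogeneous_zero _ _ _
  · have hsum := hf.sum_X_mul_pderiv
    rw [one_smul] at hsum
    rw [← hsum]
    simp only [hc, map_add, map_sum, map_mul, aeval_X, Fintype.sum_sum_type, Fin.sum_univ_two,
      Sum.elim_inl, Sum.elim_inr, aeval_C, algebraMap_eq, Matrix.cons_val_zero,
      Matrix.cons_val_one, zero_mul, add_zero]
    change L + C (-(c (Sum.inr 0))⁻¹) * L * C (c (Sum.inr 0)) = 0
    rw [mul_right_comm, ← C_mul, neg_mul, inv_mul_cancel₀ hc0, C_neg, C_1]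
    ring

/-- Substituting so that one of the linear forms vanishes shortens the representation by one. -/
lemma IsSumOfLinearProducts.of_sum_mul_eq {σ : Type*} [Fintype σ] {r : ℕ} {P : MvPolynomial σ ℂ}
    {a b : Fin (r + 1) → MvPolynomial (σ ⊕ Fin 2) ℂ}
    (ha : ∀ i, (a i).IsHomogeneous 1) (hb : ∀ i, (b i).IsHomogeneous 1)
    (hQ : MvPolynomial.rename Sum.inl P + X (Sum.inr 0) * X (Sum.inr 1) = ∑ i, a i * b i)
    {i : Fin (r + 1)} (hi : pderiv (Sum.inr 0) (a i) ≠ 0) :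
    IsSumOfLinearProducts r (MvPolynomial.rename (Sum.inl : σ → σ ⊕ Fin 2) P) := by
  obtain ⟨φ, hφ, hinl, hinr, h0⟩ := exists_aeval_eq_zero (ha i) hi
  refine ⟨fun j => aeval φ (a (i.succAbove j)), fun j => aeval φ (b (i.succAbove j)),
    fun j => (ha _).aeval φ hφ, fun j => (hb _).aeval φ hφ, ?_⟩
  have h := congrArg (aeval φ) hQ
  rw [Fin.sum_univ_succAbove _ i] at h
  have hP : aeval φ (MvPolynomial.rename Sum.inl P) = MvPolynomial.rename Sum.inl P := by
    rw [aeval_rename, show φ ∘ Sum.inl = X ∘ Sum.inl from funext hinl]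
    exact DFunLike.congr_fun (algHom_ext fun j => by simp) P
  simpa only [map_add, map_mul, map_sum, aeval_X, hP, hinr, h0, mul_zero, zero_mul, add_zero,
    zero_add] using h

lemma IsSumOfLinearProducts.exists_of_add_mul {σ : Type*} [Fintype σ] {r : ℕ}
    {P : MvPolynomial σ ℂ} (h : IsSumOfLinearProducts r
      (MvPolynomial.rename Sum.inl P + X (Sum.inr 0 : σ ⊕ Fin 2) * X (Sum.inr 1))) :
    ∃ n, r = n + 1 ∧
      IsSumOfLinearProducts n (MvPolynomial.rename (Sum.inl : σ → σ ⊕ Fin 2) P) := by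
  obtain ⟨a, b, ha, hb, hQ⟩ := h
  have hex : ∃ i, pderiv (Sum.inr 0) (a i) ≠ 0 ∨ pderiv (Sum.inr 0) (b i) ≠ 0 := by
    by_contra! hzero
    have hd := congrArg (pderiv (Sum.inr 0)) hQ
    rw [map_add, pderiv_inr_rename_inl, pderiv_mul, pderiv_X_self,
      pderiv_X_of_ne (by simp), map_sum] at hd
    simp [hzero] at hd
  obtain ⟨i, hi⟩ := hex
  obtain _ | n := r
  · exact i.elim0
  refine ⟨n, rfl, ?_⟩
  rcases hi with hi | hi
  · exact .of_sum_mul_eq ha hb hQ hi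
  · exact .of_sum_mul_eq hb ha (by simpa only [mul_comm (b _)] using hQ) hi

/-- For a homogeneous quadratic `P₁ ∈ ℂ[x₁,…,x_k]` and the quadratic
`P₂ = y₁·y₂` in two fresh variables, `rankS (P₁ + P₂) = rankS P₁ + 1` and
`y₁, y₂ ∈ MS (P₁ + P₂)`. -/
theorem statement4 {k : ℕ} (P₁ : MvPolynomial (Fin k) ℂ) (hP₁ : P₁.IsHomogeneous 2) :
    rankS (rename (Sum.inl : Fin k → Fin k ⊕ Fin 2) P₁
        + X (Sum.inr 0 : Fin k ⊕ Fin 2) * X (Sum.inr 1 : Fin k ⊕ Fin 2))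
      = rankS (rename (Sum.inl : Fin k → Fin k ⊕ Fin 2) P₁) + 1 ∧
    X (Sum.inr 0 : Fin k ⊕ Fin 2) ∈
      MS (rename (Sum.inl : Fin k → Fin k ⊕ Fin 2) P₁
        + X (Sum.inr 0 : Fin k ⊕ Fin 2) * X (Sum.inr 1 : Fin k ⊕ Fin 2)) ∧
    X (Sum.inr 1 : Fin k ⊕ Fin 2) ∈
      MS (rename (Sum.inl : Fin k → Fin k ⊕ Fin 2) P₁
        + X (Sum.inr 0 : Fin k ⊕ Fin 2) * X (Sum.inr 1 : Fin k ⊕ Fin 2)) := by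
  refine ⟨le_antisymm ?_ ?_, ?_, ?_⟩
  · exact (((isSumOfLinearProducts_of_isHomogeneous_two hP₁).rename Sum.inl).rankS.add_mul
      (isHomogeneous_X ℂ _) (isHomogeneous_X ℂ _)).rankS_le
  · obtain ⟨n, hn, h⟩ := (((isSumOfLinearProducts_of_isHomogeneous_two hP₁).rename
      Sum.inl).add_mul (isHomogeneous_X ℂ (Sum.inr 0 : Fin k ⊕ Fin 2))
      (isHomogeneous_X ℂ (Sum.inr 1))).rankS.exists_of_add_mul
    rw [hn]
    exact Nat.succ_le_succ h.rankS_le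
  · convert pderiv_mem_MS _ (Sum.inr 1 : Fin k ⊕ Fin 2) using 1
    rw [map_add, pderiv_inr_rename_inl, pderiv_mul, pderiv_X_self, pderiv_X_of_ne (by simp)]
    simp
  · convert pderiv_mem_MS _ (Sum.inr 0 : Fin k ⊕ Fin 2) using 1
    rw [map_add, pderiv_inr_rename_inl, pderiv_mul, pderiv_X_self, pderiv_X_of_ne (by simp)]
    simp
end

section
/- Let W be a ℂ-vector space and let V₁, …, V_m ⊆ W (m ≥ 1) be subspaces such that dim V_i = 2 for every i and dim(V_i ∩ V_j) = 1 for all i ≠ j. Then either dim(⋂_{i=1}^m V_i) ≥ 1 or dim(V₁ + ⋯ + V_m) ≤ 3. -/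
/-- If three planes meet pairwise in lines and `C` is not contained in `A ⊔ B`, then the
line `A ⊓ B` is the trace of `A ⊔ B` on `C`. -/
theorem Submodule.inf_eq_inf_sup_of_not_le {K W : Type*} [Field K] [AddCommGroup W] [Module K W]
    {A B C : Submodule K W} (hC : Module.finrank K C = 2)
    (hAB : Module.finrank K ↥(A ⊓ B) = 1) (hCA : Module.finrank K ↥(C ⊓ A) = 1)
    (hCB : Module.finrank K ↥(C ⊓ B) = 1) (h : ¬ C ≤ A ⊔ B) : A ⊓ B = C ⊓ (A ⊔ B) := by
  have : FiniteDimensional K C := Module.finite_of_finrank_pos (by omega)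
  have : FiniteDimensional K ↥(A ⊓ B) := Module.finite_of_finrank_pos (by omega)
  have hlt : Module.finrank K ↥(C ⊓ (A ⊔ B)) < Module.finrank K C :=
    Submodule.finrank_lt_finrank_of_lt (inf_lt_left.mpr h)
  have eA : C ⊓ A = C ⊓ (A ⊔ B) :=
    Submodule.eq_of_le_of_finrank_le (inf_le_inf_left _ le_sup_left) (by omega)
  have eB : C ⊓ B = C ⊓ (A ⊔ B) :=
    Submodule.eq_of_le_of_finrank_le (inf_le_inf_left _ le_sup_right) (by omega)
  have hle : C ⊓ (A ⊔ B) ≤ A ⊓ B := le_inf (eA ▸ inf_le_right) (eB ▸ inf_le_right)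
  exact (Submodule.eq_of_le_of_finrank_le hle (by rw [← eA]; omega)).symm

/-- If `V₁, …, V_m` are two-dimensional subspaces of a `ℂ`-vector space
with pairwise one-dimensional intersections, then either all of them share a common
nonzero vector, or their sum has dimension at most `3`. -/
theorem statement7 (W : Type*) [AddCommGroup W] [Module ℂ W] (m : ℕ) (hm : 1 ≤ m)
    (V : Fin m → Submodule ℂ W)
    (hdim : ∀ i, Module.finrank ℂ (V i) = 2)
    (hint : ∀ i j, i ≠ j → Module.finrank ℂ ↥(V i ⊓ V j) = 1) :
    1 ≤ Module.finrank ℂ ↥(⨅ i, V i) ∨ Module.finrank ℂ ↥(⨆ i, V i) ≤ 3 := by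
  have hfin : ∀ i, FiniteDimensional ℂ (V i) := fun i =>
    Module.finite_of_finrank_pos (by have := hdim i; omega)
  let a : Fin m := ⟨0, hm⟩
  have : FiniteDimensional ℂ ↥(⨅ i, V i) :=
    Submodule.finiteDimensional_of_le (iInf_le V a)
  by_cases hb : ∃ b, a ≠ b
  · obtain ⟨b, hab⟩ := hb
    by_cases hL : ∀ k, V a ⊓ V b ≤ V k
    · left
      rw [← hint a b hab]
      exact Submodule.finrank_mono (le_iInf hL)
    · right
      push Not at hL
      obtain ⟨k, hk⟩ := hL
      have key : ∀ j, ¬ V j ≤ V a ⊔ V b → V a ⊓ V b = V j ⊓ (V a ⊔ V b) := fun j hj =>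
        Submodule.inf_eq_inf_sup_of_not_le (hdim j) (hint a b hab)
          (hint j a fun h => hj (h ▸ le_sup_left))
          (hint j b fun h => hj (h ▸ le_sup_right)) hj
      have hkS : V k ≤ V a ⊔ V b := by
        by_contra h
        exact hk (key k h ▸ inf_le_left)
      have hS : ⨆ i, V i ≤ V a ⊔ V b := by
        refine iSup_le fun j => ?_
        by_contra h
        have hle : V j ⊓ V k ≤ V a ⊓ V b := key j h ▸ inf_le_inf_left _ hkS
        have heq := Submodule.eq_of_le_of_finrank_le hle
          (by rw [hint a b hab, hint j k fun e => h (e ▸ hkS)])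
        exact hk (heq ▸ inf_le_right)
      have hsum := Submodule.finrank_sup_add_finrank_inf_eq (V a) (V b)
      rw [hint a b hab, hdim, hdim] at hsum
      have := Submodule.finrank_mono hS
      omega
  · left
    push Not at hb
    have hle : V a ≤ ⨅ i, V i := le_iInf fun i => (congrArg V (hb i)).le
    have := Submodule.finrank_mono hle
    rw [hdim] at this
    omega
end

section
/- Let V ⊆ span_ℂ{x₁,…,xₙ} be a Δ-dimensional space of linear forms, and let F, G ∈ ℂ[x₁,…,xₙ] be polynomials with no common irreducible factor. Then for almost every α ∈ [0,1]^Δ (with respect to Lebesgue measure), every common factor of T_{α,V}(F) and T_{α,V}(G) is a polynomial in the variable z alone; in particular T_{α,V}(F) and T_{α,V}(G) have no common factor that is not a polynomial in z. -/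
open MvPolynomial MeasureTheory

/-- Coprime polynomials over a unique factorization domain satisfy a Bézout relation with a nonzero
constant. -/
theorem Polynomial.exists_mul_add_mul_eq_C_of_isRelPrime {R : Type*} [CommRing R] [IsDomain R]
    [UniqueFactorizationMonoid R] {f g : Polynomial R} (hfg : IsRelPrime f g) :
    ∃ (a b : Polynomial R) (r : R), r ≠ 0 ∧ a * f + b * g = Polynomial.C r := by
  let : NormalizedGCDMonoid R := Nonempty.some inferInstance
  let K := FractionRing R
  have hinj : Function.Injective (algebraMap R K) := IsFractionRing.injective R K
  have hne : ¬(f.map (algebraMap R K) = 0 ∧ g.map (algebraMap R K) = 0) := by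
    rintro ⟨hf, hg⟩
    rw [Polynomial.map_eq_zero_iff hinj] at hf hg
    exact not_isRelPrime_zero_zero (hf ▸ hg ▸ hfg)
  have hco : IsCoprime (f.map (algebraMap R K)) (g.map (algebraMap R K)) := by
    refine isCoprime_of_irreducible_dvd hne fun d hd hdf hdg => hd.not_isUnit ?_
    set p := (IsLocalization.integerNormalization (nonZeroDivisors R) d).primPart
    obtain ⟨c, c0, hc⟩ := IsLocalization.integerNormalization_spec (nonZeroDivisors R) d
    have hpd : p.map (algebraMap R K) ∣ d := by
      have hdvd : p.map (algebraMap R K) ∣ c • d := by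
        rw [← hc]
        exact Polynomial.map_dvd _ (Polynomial.primPart_dvd _)
      have hu : IsUnit (algebraMap R K c) :=
        IsLocalization.map_units K (⟨c, c0⟩ : nonZeroDivisors R)
      rw [Algebra.smul_def, Polynomial.algebraMap_apply] at hdvd
      exact ((hu.map Polynomial.C).dvd_mul_left).1 hdvd
    have hprim : p.IsPrimitive := Polynomial.isPrimitive_primPart _
    exact Polynomial.isUnit_or_eq_zero_of_isUnit_integerNormalization_primPart hd.ne_zero
      (hfg (hprim.dvd_of_fraction_map_dvd_fraction_map (hpd.trans hdf))
        (hprim.dvd_of_fraction_map_dvd_fraction_map (hpd.trans hdg)))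
  obtain ⟨a, b, hab⟩ := hco
  obtain ⟨c, c0, hc⟩ := IsLocalization.integerNormalization_spec (nonZeroDivisors R) a
  obtain ⟨d, d0, hd⟩ := IsLocalization.integerNormalization_spec (nonZeroDivisors R) b
  refine ⟨Polynomial.C d * IsLocalization.integerNormalization (nonZeroDivisors R) a,
    Polynomial.C c * IsLocalization.integerNormalization (nonZeroDivisors R) b, c * d,
    mul_ne_zero (nonZeroDivisors.ne_zero c0) (nonZeroDivisors.ne_zero d0), ?_⟩
  apply Polynomial.map_injective _ hinj
  rw [Algebra.smul_def, Polynomial.algebraMap_apply] at hc hd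
  simp only [Polynomial.map_add, Polynomial.map_mul, Polynomial.map_C, hc, hd, map_mul]
  linear_combination Polynomial.C (algebraMap R K c) * Polynomial.C (algebraMap R K d) * hab

namespace MvPolynomial

/-- A variable can be eliminated between two coprime polynomials. -/
theorem exists_mul_add_mul_notMem_vars {σ k : Type*} [Field k] {F G : MvPolynomial σ k}
    (hFG : IsRelPrime F G) (s : σ) :
    ∃ A B : MvPolynomial σ k, A * F + B * G ≠ 0 ∧ s ∉ (A * F + B * G).vars := by
  classical
  let e : MvPolynomial σ k ≃ₐ[k] Polynomial (MvPolynomial {t // t ≠ s} k) :=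
    (renameEquiv k (Equiv.optionSubtypeNe s).symm).trans (optionEquivLeft k _)
  have hrel : IsRelPrime (e F) (e G) := fun d hF hG => by
    have := hFG (d := e.symm d) (by simpa using map_dvd e.symm hF)
      (by simpa using map_dvd e.symm hG)
    simpa using this.map e
  obtain ⟨a, b, r, hr, h⟩ := Polynomial.exists_mul_add_mul_eq_C_of_isRelPrime hrel
  have key : e.symm a * F + e.symm b * G = rename Subtype.val r := by
    apply e.injective
    rw [map_add, map_mul, map_mul, e.apply_symm_apply, e.apply_symm_apply, h]
    have : e (rename Subtype.val r) = optionEquivLeft k _ (rename some r) := by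
      simp only [e, AlgEquiv.trans_apply, renameEquiv_apply, rename_rename]
      congr 3
      ext x : 1
      simp [x.2]
    rw [this, ← AlgEquiv.symm_apply_eq]
    simp [optionEquivLeft]
  refine ⟨e.symm a, e.symm b, ?_, ?_⟩
  · rw [key]
    exact fun h0 => hr (rename_injective _ Subtype.val_injective (by simpa using h0))
  · rw [key]
    intro hs
    obtain ⟨t, -, ht⟩ := Finset.mem_image.1 (vars_rename _ r hs)
    exact t.2 ht

/-- The real zeros of a nonzero complex polynomial form a null set. -/
theorem ae_eval_ofReal_ne_zero {m : ℕ} {q : MvPolynomial (Fin m) ℂ} (hq : q ≠ 0) :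
    ∀ᵐ α : Fin m → ℝ, eval (fun i => (α i : ℂ)) q ≠ 0 := by
  induction m with
  | zero =>
    refine Filter.Eventually.of_forall fun α h => hq ?_
    rw [eq_C_of_isEmpty q] at h ⊢
    simpa using h
  | succ m ih =>
    set Q := finSuccEquiv ℂ m q with hQ
    have hQ0 : Q ≠ 0 := by simpa [hQ] using hq
    have hmp := volume_preserving_piFinSuccAbove (fun _ : Fin (m + 1) => ℝ) 0
    have hcont : Continuous fun x : ℝ × (Fin m → ℝ) =>
        eval (Fin.cons (x.1 : ℂ) fun i => (x.2 i : ℂ)) q := by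
      refine (MvPolynomial.continuous_eval q).comp (continuous_pi fun i => ?_)
      refine Fin.cases ?_ (fun j => ?_) i
      · simp only [Fin.cons_zero]
        fun_prop
      · simp only [Fin.cons_succ]
        fun_prop
    have hprod : ∀ᵐ x : ℝ × (Fin m → ℝ),
        eval (Fin.cons (x.1 : ℂ) fun i => (x.2 i : ℂ)) q ≠ 0 := by
      have hmeas : MeasurableSet {x : (Fin m → ℝ) × ℝ |
          eval (Fin.cons (x.2 : ℂ) fun i => (x.1 i : ℂ)) q ≠ 0} :=
        (isOpen_ne.preimage (hcont.comp continuous_swap)).measurableSet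
      have hswap : ∀ᵐ x : (Fin m → ℝ) × ℝ,
          eval (Fin.cons (x.2 : ℂ) fun i => (x.1 i : ℂ)) q ≠ 0 := by
        refine (Measure.ae_prod_iff_ae_ae hmeas).2 ?_
        filter_upwards [ih (Polynomial.leadingCoeff_ne_zero.2 hQ0)] with y hy
        set P := Q.map (eval fun i => (y i : ℂ)) with hP
        have hP0 : P ≠ 0 := fun h0 => hy <| by
          have := congrArg (fun p => p.coeff Q.natDegree) h0
          simpa [hP, Polynomial.coeff_map] using this
        have hfin : {t : ℝ | (t : ℂ) ∈ P.rootSet ℂ}.Finite :=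
          (P.rootSet_finite ℂ).preimage Complex.ofReal_injective.injOn
        filter_upwards [measure_eq_zero_iff_ae_notMem.1 (hfin.measure_zero volume)] with t ht h0
        refine ht ?_
        rw [Polynomial.mem_rootSet_of_ne hP0]
        rw [eval_eq_eval_mv_eval'] at h0
        simpa using h0
      exact (Measure.measurePreserving_swap (μ := (volume : Measure ℝ))
        (ν := (volume : Measure (Fin m → ℝ)))).quasiMeasurePreserving.ae hswap
    filter_upwards [hmp.quasiMeasurePreserving.ae hprod] with α hα
    convert hα using 2
    congr 1
    ext i
    refine Fin.cases ?_ (fun j => ?_) i <;> simp [MeasurableEquiv.piFinSuccAbove, Fin.tail]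

/-- A divisor of a nonzero polynomial involves no new variables. -/
theorem vars_subset_of_dvd {σ R : Type*} [CommRing R] [IsDomain R] {p q : MvPolynomial σ R}
    (hq : q ≠ 0) (h : p ∣ q) : p.vars ⊆ q.vars := by
  obtain ⟨r, rfl⟩ := h
  intro i
  rw [mem_vars_iff_degreeOf_ne_zero, mem_vars_iff_degreeOf_ne_zero,
    degreeOf_mul_eq (left_ne_zero_of_mul hq) (right_ne_zero_of_mul hq)]
  lia

theorem exists_eq_aeval_X_of_vars_subset {σ R : Type*} [CommRing R] {h : MvPolynomial σ R} {s : σ}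
    (hs : ∀ t ∈ h.vars, t = s) : ∃ p : Polynomial R, h = Polynomial.aeval (X s) p := by
  obtain ⟨q, rfl⟩ := exists_rename_eq_of_vars_subset_range h (fun _ : Unit => s)
    (Function.injective_of_subsingleton _) fun t ht => ⟨(), (hs t ht).symm⟩
  refine ⟨uniqueAlgEquiv R Unit q, ?_⟩
  have : rename (fun _ : Unit => s) =
      (Polynomial.aeval (X s : MvPolynomial σ R)).comp (uniqueAlgEquiv R Unit).toAlgHom := by
    ext; simp
  exact DFunLike.congr_fun this q

/-- A family of linear forms that is a basis of the space of linear forms is a system of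
coordinates. -/
theorem exists_algEquiv_X_eq {σ τ k : Type*} [Fintype σ] [Field k]
    (b : σ → MvPolynomial τ k) (hb : LinearIndependent k b)
    (hspan : Submodule.span k (Set.range b) =
      Submodule.span k (Set.range (X : τ → MvPolynomial τ k))) :
    ∃ φ : MvPolynomial σ k ≃ₐ[k] MvPolynomial τ k, ∀ s, φ (X s) = b s := by
  have hX : ∀ i, ∃ c : σ → k, ∑ s, c s • b s = X i := fun i =>
    (Submodule.mem_span_range_iff_exists_fun k).1
      (hspan ▸ Submodule.subset_span (Set.mem_range_self i))
  choose c hc using hX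
  let φ : MvPolynomial σ k →ₐ[k] MvPolynomial τ k := aeval b
  let ψ : MvPolynomial τ k →ₐ[k] MvPolynomial σ k := aeval fun i => ∑ s, c i s • X s
  have hφψ : φ.comp ψ = AlgHom.id k _ := by
    ext1 i
    simp [φ, ψ, hc]
  have hψb : ∀ p ∈ Submodule.span k (Set.range b),
      ψ p ∈ Submodule.span k (Set.range (X : σ → MvPolynomial σ k)) := by
    intro p hp
    rw [hspan] at hp
    have hle : Submodule.span k (Set.range (X : τ → MvPolynomial τ k)) ≤
        (Submodule.span k (Set.range (X : σ → MvPolynomial σ k))).comap ψ.toLinearMap := by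
      rw [Submodule.span_le]
      rintro _ ⟨i, rfl⟩
      simp only [SetLike.mem_coe, Submodule.mem_comap, AlgHom.toLinearMap_apply, ψ, aeval_X]
      exact Submodule.sum_mem _ fun s _ =>
        Submodule.smul_mem _ _ (Submodule.subset_span (Set.mem_range_self s))
    exact hle hp
  have hψφ : ψ.comp φ = AlgHom.id k _ := by
    classical
    ext1 s
    obtain ⟨d, hd⟩ := (Submodule.mem_span_range_iff_exists_fun k).1
      (hψb (b s) (Submodule.subset_span (Set.mem_range_self s)))
    have hds : ∑ t, d t • b t = ∑ t, (Pi.single s 1 : σ → k) t • b t := by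
      have h1 : φ (ψ (b s)) = b s := DFunLike.congr_fun hφψ (b s)
      rw [← hd] at h1
      simpa [φ, Pi.single_apply] using h1
    have hd' : ∀ t, d t = (Pi.single s 1 : σ → k) t := by
      have h2 := Fintype.linearIndependent_iff.1 hb (fun t => d t - (Pi.single s 1 : σ → k) t)
        (by simp only [sub_smul, Finset.sum_sub_distrib, hds, sub_self])
      exact fun t => sub_eq_zero.1 (h2 t)
    simp only [AlgHom.comp_apply, φ, aeval_X, AlgHom.id_apply, ← hd, hd']
    simp [Pi.single_apply]
  exact ⟨AlgEquiv.ofAlgHom φ ψ hφψ hψφ, fun s => by simp [φ]⟩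

/-- Coordinates on `k[x]` extend to coordinates on `k[x, z]`. -/
theorem exists_algEquiv_option {σ τ k : Type*} [CommRing k]
    (φ : MvPolynomial σ k ≃ₐ[k] MvPolynomial τ k) :
    ∃ Φ : MvPolynomial (Option σ) k ≃ₐ[k] MvPolynomial (Option τ) k,
      Φ (X none) = X none ∧ ∀ s, Φ (X (some s)) = rename some (φ (X s)) := by
  refine ⟨(optionEquivLeft k σ).trans ((Polynomial.mapAlgEquiv φ).trans
    (optionEquivLeft k τ).symm), by simp, fun s => ?_⟩
  simp only [AlgEquiv.trans_apply, optionEquivLeft_X_some, Polynomial.mapAlgEquiv]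
  simp [optionEquivLeft]

/-- For almost every real `α`, the substitution `y i ↦ α i • z` does not annihilate a given nonzero
polynomial. -/
theorem ae_aeval_smul_X_none_ne_zero {m : ℕ} {κ : Type*} {r : MvPolynomial (Fin m ⊕ κ) ℂ}
    (hr : r ≠ 0) :
    ∀ᵐ α : Fin m → ℝ, aeval (Sum.elim (fun i => (α i : ℂ) • X none) fun j => X (some (Sum.inr j)) :
      Fin m ⊕ κ → MvPolynomial (Option (Fin m ⊕ κ)) ℂ) r ≠ 0 := by
  obtain ⟨x, hx⟩ : ∃ x, eval x r ≠ 0 := by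
    by_contra! h
    exact hr (funext fun x => by simpa using h x)
  let q : MvPolynomial (Fin m) ℂ := aeval (Sum.elim X fun j => C (x (Sum.inr j))) r
  have hqe : ∀ y : Fin m → ℂ, eval y q = eval (Sum.elim y fun j => x (Sum.inr j)) r := by
    intro y
    have : (aeval y).comp (aeval (Sum.elim X fun j => C (x (Sum.inr j)))) =
        (aeval (Sum.elim y fun j => x (Sum.inr j)) : MvPolynomial (Fin m ⊕ κ) ℂ →ₐ[ℂ] ℂ) := by
      ext (i | j) <;> simp
    simpa only [AlgHom.comp_apply, aeval_eq_eval] using DFunLike.congr_fun this r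
  have hq : q ≠ 0 := by
    intro h0
    apply hx
    have := hqe fun i => x (Sum.inl i)
    rw [h0, map_zero] at this
    rw [this]
    congr 2
    ext (i | j) <;> rfl
  filter_upwards [ae_eval_ofReal_ne_zero hq] with α hα h0
  apply hα
  rw [hqe]
  let w : Option (Fin m ⊕ κ) → ℂ := fun o => o.elim 1 x
  have : (aeval w).comp (aeval (Sum.elim (fun i => (α i : ℂ) • X none)
      fun j => X (some (Sum.inr j)))) =
      (aeval (Sum.elim (fun i => (α i : ℂ)) fun j => x (Sum.inr j)) :
        MvPolynomial (Fin m ⊕ κ) ℂ →ₐ[ℂ] ℂ) := by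
    ext (i | j) <;> simp [w, -Complex.coe_smul]
  have := DFunLike.congr_fun this r
  rw [AlgHom.comp_apply, h0, map_zero] at this
  simpa [aeval_eq_eval] using this.symm

/-- For almost every real `α`, a common divisor of the images of two coprime polynomials under
`y i ↦ α i • z` does not involve a given variable other than `z`. -/
theorem ae_notMem_vars_of_dvd_aeval_smul_X_none {m : ℕ} {κ : Type*}
    {F G : MvPolynomial (Fin m ⊕ κ) ℂ} (hFG : IsRelPrime F G) (s : Fin m ⊕ κ) :
    ∀ᵐ α : Fin m → ℝ, ∀ h : MvPolynomial (Option (Fin m ⊕ κ)) ℂ,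
      h ∣ aeval (Sum.elim (fun i => (α i : ℂ) • X none) fun j => X (some (Sum.inr j))) F →
      h ∣ aeval (Sum.elim (fun i => (α i : ℂ) • X none) fun j => X (some (Sum.inr j))) G →
      some s ∉ h.vars := by
  classical
  obtain ⟨A, B, hr, hs⟩ := exists_mul_add_mul_notMem_vars hFG s
  filter_upwards [ae_aeval_smul_X_none_ne_zero hr] with α hα h hF hG hmem
  have hdvd : h ∣ aeval (Sum.elim (fun i => (α i : ℂ) • X none)
      fun j => X (some (Sum.inr j))) (A * F + B * G) := by
    rw [map_add, map_mul, map_mul]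
    exact dvd_add (hF.mul_left _) (hG.mul_left _)
  obtain ⟨t, ht, hst⟩ := Finset.mem_biUnion.1 (vars_bind₁ _ _ (vars_subset_of_dvd hα hdvd hmem))
  rcases t with i | j
  · rw [Sum.elim_inl, smul_eq_C_mul] at hst
    simpa using vars_mul _ _ hst
  · rw [Sum.elim_inr, vars_X, Finset.mem_singleton, Option.some_inj] at hst
    exact hs (hst ▸ ht)

end MvPolynomial

/-- Let `V` be a `Δ`-dimensional space of linear forms with basis `v`,
let `u` be a basis of a complement of `V` inside the span of the variables, and for
`α ∈ ℂ^Δ` let `T α` be the algebra homomorphism into `ℂ[x₁,…,xₙ,z]` with `v i ↦ α i · z`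
and `u j ↦ u j`. If `F` and `G` have no common irreducible factor, then for almost every
`α ∈ [0,1]^Δ` every common factor of `T α F` and `T α G` is a polynomial in `z` alone. -/
theorem statement8 {n Δ : ℕ}
    (v : Fin Δ → MvPolynomial (Fin n) ℂ) (u : Fin (n - Δ) → MvPolynomial (Fin n) ℂ)
    (hv : ∀ i, (v i).IsHomogeneous 1) (hu : ∀ j, (u j).IsHomogeneous 1)
    (hindep : LinearIndependent ℂ (Sum.elim v u))
    (hspan : Submodule.span ℂ (Set.range v ∪ Set.range u)
      = Submodule.span ℂ (Set.range (X : Fin n → MvPolynomial (Fin n) ℂ)))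
    (F G : MvPolynomial (Fin n) ℂ)
    (hFG : ∀ h : MvPolynomial (Fin n) ℂ, Irreducible h → ¬(h ∣ F ∧ h ∣ G))
    (T : (Fin Δ → ℝ) → (MvPolynomial (Fin n) ℂ →ₐ[ℂ] MvPolynomial (Option (Fin n)) ℂ))
    (hTv : ∀ α i, T α (v i) = ((α i : ℂ)) • X (none : Option (Fin n)))
    (hTu : ∀ α j, T α (u j) = rename (some : Fin n → Option (Fin n)) (u j)) :
    ∀ᵐ α ∂(volume.restrict (Set.univ.pi fun _ : Fin Δ => Set.Icc (0 : ℝ) 1)),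
      ∀ h : MvPolynomial (Option (Fin n)) ℂ, h ∣ T α F → h ∣ T α G →
        ∃ p : Polynomial ℂ, h = Polynomial.aeval (X (none : Option (Fin n))) p := by
  obtain ⟨φ, hφ⟩ := exists_algEquiv_X_eq (Sum.elim v u) hindep (by rw [Set.Sum.elim_range, hspan])
  obtain ⟨Φ, hΦz, hΦ⟩ := exists_algEquiv_option φ
  have hT : ∀ α p, T α (φ p) = Φ (aeval (Sum.elim (fun i => (α i : ℂ) • X none)
      fun j => X (some (Sum.inr j))) p) := by
    intro α p
    have : (T α).comp φ.toAlgHom = Φ.toAlgHom.comp (aeval (Sum.elim (fun i => (α i : ℂ) • X none)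
        fun j => X (some (Sum.inr j)))) := by
      ext1 (i | j)
      · simp [hφ, hTv, hΦz, -Complex.coe_smul]
      · simp [hφ, hTu, hΦ]
    exact DFunLike.congr_fun this p
  have hrel : Fin Δ ⊕ Fin (n - Δ) → IsRelPrime (φ.symm F) (φ.symm G) := by
    intro s
    refine WfDvdMonoid.isRelPrime_of_no_irreducible_factors ?_ fun p hp hpF hpG =>
      hFG (φ p) ((MulEquiv.irreducible_iff φ).2 hp)
        ⟨by simpa using map_dvd φ hpF, by simpa using map_dvd φ hpG⟩
    rintro ⟨hF, hG⟩
    rw [EmbeddingLike.map_eq_zero_iff] at hF hG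
    exact hFG (φ (X s)) ((MulEquiv.irreducible_iff φ).2 (X_prime.irreducible))
      ⟨hF ▸ dvd_zero _, hG ▸ dvd_zero _⟩
  refine ae_restrict_of_ae ?_
  filter_upwards [ae_all_iff.2 fun s => ae_notMem_vars_of_dvd_aeval_smul_X_none (hrel s) s]
    with α hα h hF hG
  have hdvd : ∀ P, h ∣ T α P → Φ.symm h ∣ aeval (Sum.elim (fun i => (α i : ℂ) • X none)
      fun j => X (some (Sum.inr j))) (φ.symm P) := by
    intro P hP
    rw [← φ.apply_symm_apply P, hT] at hP
    simpa using map_dvd Φ.symm hP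
  obtain ⟨p, hp⟩ := exists_eq_aeval_X_of_vars_subset (h := Φ.symm h) (s := none) fun t ht => by
    rcases t with _ | s
    · rfl
    · exact absurd ht (hα s _ (hdvd F hF) (hdvd G hG))
  refine ⟨p, ?_⟩
  rw [← Φ.apply_symm_apply h, hp, ← Polynomial.aeval_algHom_apply, hΦz]
end

section
/- Let V ⊆ span_ℂ{x₁,…,xₙ} be a Δ-dimensional space of linear forms, and let F, G ∈ ℂ[x₁,…,xₙ] be linearly independent irreducible homogeneous quadratics with MS(F) ⊄ V and MS(G) ⊄ V. Then for almost every α ∈ [0,1]^Δ (with respect to Lebesgue measure), the polynomials T_{α,V}(F) and T_{α,V}(G) are linearly independent over ℂ. -/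
open MvPolynomial MeasureTheory

/-- A basis of the space of linear forms is a system of coordinates on the polynomial ring. -/
theorem exists_algEquiv_apply_eq_X {K σ ι : Type*} [Field K] [Fintype ι]
    (w : ι → MvPolynomial σ K) (hw : LinearIndependent K w)
    (hspan : Submodule.span K (Set.range w)
      = Submodule.span K (Set.range (X : σ → MvPolynomial σ K))) :
    ∃ e : MvPolynomial σ K ≃ₐ[K] MvPolynomial ι K, ∀ k, e (w k) = X k := by
  classical
  have hX : ∀ i, ∃ c : ι → K, ∑ k, c k • w k = X i := fun i => by
    rw [← Submodule.mem_span_range_iff_exists_fun, hspan]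
    exact Submodule.subset_span ⟨i, rfl⟩
  choose c hc using hX
  let φ : MvPolynomial ι K →ₐ[K] MvPolynomial σ K := aeval w
  let ψ : MvPolynomial σ K →ₐ[K] MvPolynomial ι K := aeval fun i => ∑ k, c i k • X k
  have hφψ : φ.comp ψ = AlgHom.id K _ := by
    ext1 i
    simp [φ, ψ, hc]
  have hmem : ∀ p ∈ Submodule.span K (Set.range (X : σ → MvPolynomial σ K)),
      ψ p ∈ Submodule.span K (Set.range (X : ι → MvPolynomial ι K)) := by
    intro p hp
    refine (Submodule.span_le (p := (Submodule.span K (Set.range X)).comap ψ.toLinearMap)).2 ?_ hp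
    rintro _ ⟨i, rfl⟩
    have : ψ (X i) = ∑ k, c i k • X k := aeval_X _ _
    simp only [Submodule.comap_coe, Set.mem_preimage, AlgHom.toLinearMap_apply, SetLike.mem_coe,
      this]
    exact Submodule.sum_mem _ fun k _ => Submodule.smul_mem _ _ (Submodule.subset_span ⟨k, rfl⟩)
  have hψ : ∀ k, ψ (w k) = X k := by
    intro k
    have hk : w k ∈ Submodule.span K (Set.range (X : σ → MvPolynomial σ K)) :=
      hspan ▸ Submodule.subset_span ⟨k, rfl⟩
    obtain ⟨g, hg⟩ := (Submodule.mem_span_range_iff_exists_fun K).1 (hmem _ hk)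
    have h1 : ∑ l, g l • w l = w k := by
      have := congrArg φ hg
      rw [show φ (ψ (w k)) = w k from DFunLike.congr_fun hφψ (w k)] at this
      simpa [φ] using this
    have h2 : g = Pi.single k 1 := by
      apply (linearIndependent_iff_injective_fintypeLinearCombination.1 hw)
      simpa [Fintype.linearCombination_apply] using h1
    rw [← hg, h2]
    simp [Pi.single_apply]
  refine ⟨AlgEquiv.ofAlgHom ψ φ ?_ hφψ, hψ⟩
  ext1 k
  simp [φ, hψ]

/-- The real zero set of a nonzero complex polynomial is Lebesgue-null. -/
theorem MvPolynomial.ae_eval_ofReal_ne_zero_s9 :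
    ∀ {k : ℕ} {f : MvPolynomial (Fin k) ℂ}, f ≠ 0 →
      ∀ᵐ α : Fin k → ℝ, eval (fun i => (α i : ℂ)) f ≠ 0
  | 0, f, hf => by
    refine .of_forall fun α h => hf ?_
    rw [eq_C_of_isEmpty f] at h ⊢
    simpa using h
  | k + 1, f, hf => by
    have hlead : (finSuccEquiv ℂ k f).leadingCoeff ≠ 0 := by simpa using hf
    let S : Set (ℝ × (Fin k → ℝ)) :=
      {q | eval (fun i => ((Fin.cons q.1 q.2 : Fin (k + 1) → ℝ) i : ℂ)) f = 0}
    have hS : MeasurableSet S := by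
      refine (isClosed_singleton.preimage (f := fun q : ℝ × (Fin k → ℝ) =>
        eval (fun i => ((Fin.cons q.1 q.2 : Fin (k + 1) → ℝ) i : ℂ)) f) ?_).measurableSet
      refine (continuous_eval f).comp (continuous_pi fun i => Complex.continuous_ofReal.comp ?_)
      refine Fin.cases ?_ (fun j => ?_) i
      · simpa using continuous_fst
      · simpa [Function.comp_def] using (continuous_apply j).comp continuous_snd
    have hnull : (volume : Measure (ℝ × (Fin k → ℝ))) S = 0 := by
      rw [Measure.volume_eq_prod, Measure.prod_apply_symm hS, lintegral_eq_zero_iff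
        (measurable_measure_prodMk_right hS)]
      filter_upwards [ae_eval_ofReal_ne_zero_s9 hlead] with y hy
      let p : Polynomial ℂ := (finSuccEquiv ℂ k f).map (eval fun i => (y i : ℂ))
      have hp : p ≠ 0 := fun h => hy <| by
        have := congrArg (fun r => Polynomial.coeff r (finSuccEquiv ℂ k f).natDegree) h
        simpa [p] using this
      refine Set.Finite.measure_zero (Set.Finite.subset
        (Set.Finite.preimage (Complex.ofReal_injective.injOn) (p.rootSet_finite ℂ)) ?_) _
      intro t ht
      have hcons : (fun i => ((Fin.cons t y : Fin (k + 1) → ℝ) i : ℂ))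
          = Fin.cons (t : ℂ) fun i => (y i : ℂ) := by
        funext i
        refine Fin.cases ?_ (fun j => ?_) i <;> simp
      have ht' : eval (fun i => ((Fin.cons t y : Fin (k + 1) → ℝ) i : ℂ)) f = 0 := ht
      rw [hcons, eval_eq_eval_mv_eval'] at ht'
      simpa [Polynomial.mem_rootSet, hp, p] using ht'
    have := (volume_preserving_piFinSuccAbove (fun _ : Fin (k + 1) => ℝ) 0).quasiMeasurePreserving.ae
      (p := fun q => q ∉ S) (by simpa [ae_iff] using hnull)
    filter_upwards [this] with α hα h
    apply hα
    have h2 : (Fin.cons (α 0) (fun j => α (Fin.succ j)) : Fin (k + 1) → ℝ) = α :=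
      Fin.cons_self_tail α
    simpa [S, MeasurableEquiv.piFinSuccAbove, Fin.insertNthEquiv, Fin.removeNth, h2] using h

/-- A quadratic in finitely many variables has a minimal representation. -/
theorem exists_minimal_representation {n : ℕ} {Q : MvPolynomial (Fin n) ℂ}
    (hQ : Q.IsHomogeneous 2) :
    ∃ a b : Fin (rankS Q) → MvPolynomial (Fin n) ℂ,
      (∀ i, (a i).IsHomogeneous 1) ∧ (∀ i, (b i).IsHomogeneous 1) ∧ Q = ∑ i, a i * b i := by
  refine Nat.sInf_mem (s := {r : ℕ | ∃ a b : Fin r → MvPolynomial (Fin n) ℂ,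
    (∀ i, (a i).IsHomogeneous 1) ∧ (∀ i, (b i).IsHomogeneous 1) ∧ Q = ∑ i, a i * b i})
    ⟨n, fun i => C (2⁻¹ : ℂ) * X i, fun i => pderiv i Q, fun i => ?_, fun i => hQ.pderiv, ?_⟩
  · simpa using (isHomogeneous_C (Fin n) (2⁻¹ : ℂ)).mul (isHomogeneous_X ℂ i)
  · simp_rw [mul_assoc]
    rw [← Finset.mul_sum, hQ.sum_X_mul_pderiv, C_mul', ← Nat.cast_smul_eq_nsmul ℂ, smul_smul]
    norm_num

/-- If an algebra endomorphism fixes a quadratic `Q` and sends linear forms into a space `V` of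
linear forms, then `V` contains the minimal space of `Q`. -/
theorem MS_le_of_algHom_apply_eq {n : ℕ} {Q : MvPolynomial (Fin n) ℂ} (hQ : Q.IsHomogeneous 2)
    {V : Submodule ℂ (MvPolynomial (Fin n) ℂ)} (hV : V ≤ homogeneousSubmodule (Fin n) ℂ 1)
    (π : MvPolynomial (Fin n) ℂ →ₐ[ℂ] MvPolynomial (Fin n) ℂ)
    (hπ : ∀ a : MvPolynomial (Fin n) ℂ, a.IsHomogeneous 1 → π a ∈ V) (hπQ : π Q = Q) :
    MS Q ≤ V := by
  obtain ⟨a, b, ha, hb, hab⟩ := exists_minimal_representation hQ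
  refine le_trans (sInf_le ⟨fun i => π (a i), fun i => π (b i), fun i => hV (hπ _ (ha i)),
    fun i => hV (hπ _ (hb i)), ?_, rfl⟩) (Submodule.span_le.2 ?_)
  · simpa [hπQ] using congrArg π hab
  · rintro _ (⟨i, rfl⟩ | ⟨i, rfl⟩)
    exacts [hπ _ (ha i), hπ _ (hb i)]

/-- Two polynomials with a nonvanishing minor of coefficients are linearly independent. -/
theorem MvPolynomial.linearIndependent_pair_of_coeff {K σ : Type*} [Field K]
    {p q : MvPolynomial σ K} {d e : σ →₀ ℕ}
    (h : coeff d p * coeff e q - coeff e p * coeff d q ≠ 0) : LinearIndependent K ![p, q] := by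
  refine LinearIndependent.pair_iff.2 fun s t hst => ?_
  have hd : s * coeff d p + t * coeff d q = 0 := by simpa using congrArg (coeff d) hst
  have he : s * coeff e p + t * coeff e q = 0 := by simpa using congrArg (coeff e) hst
  constructor
  · refine (mul_eq_zero.1 ?_).resolve_right h
    linear_combination coeff e q * hd - coeff d q * he
  · refine (mul_eq_zero.1 ?_).resolve_right h
    linear_combination coeff d p * he - coeff e p * hd

/-- If all minors of coefficients of `p` and `q` vanish and `p` is a prime not dividing `q`,
then `p` is a constant. -/
theorem MvPolynomial.exists_eq_C_of_coeff_minors_eq_zero {A σ : Type*} [CommRing A] [IsDomain A]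
    {p q : MvPolynomial σ A} (hp : Prime p) (hpq : ¬ p ∣ q)
    (h : ∀ d e, coeff d p * coeff e q - coeff e p * coeff d q = 0) : ∃ a, p = C a := by
  obtain ⟨e, he⟩ := ne_zero_iff.1 fun h0 : q = 0 => hpq (h0 ▸ dvd_zero p)
  have heq : C (coeff e q) * p = C (coeff e p) * q := by
    ext d
    rw [coeff_C_mul, coeff_C_mul]
    linear_combination h d e
  have hep : coeff e p ≠ 0 := fun h0 => by
    rw [h0, C_0, zero_mul] at heq
    exact (mul_ne_zero (by simpa using he) hp.ne_zero) heq
  rcases hp.dvd_or_dvd (heq ▸ dvd_mul_left p _) with h1 | h1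
  · obtain ⟨a, -, ha⟩ := (dvd_C_iff_exists hep).1 h1
    exact ⟨a, ha⟩
  · exact (hpq h1).elim

/-- With the projection maps `T α` of Statement 8, if `F, G` are linearly
independent irreducible homogeneous quadratics whose minimal spaces are not contained in
`V = span v`, then for almost every `α ∈ [0,1]^Δ` the polynomials `T α F` and `T α G` are
linearly independent. -/
theorem statement9 {n Δ : ℕ}
    (v : Fin Δ → MvPolynomial (Fin n) ℂ) (u : Fin (n - Δ) → MvPolynomial (Fin n) ℂ)
    (hv : ∀ i, (v i).IsHomogeneous 1) (hu : ∀ j, (u j).IsHomogeneous 1)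
    (hindep : LinearIndependent ℂ (Sum.elim v u))
    (hspan : Submodule.span ℂ (Set.range v ∪ Set.range u)
      = Submodule.span ℂ (Set.range (X : Fin n → MvPolynomial (Fin n) ℂ)))
    (F G : MvPolynomial (Fin n) ℂ)
    (hF2 : F.IsHomogeneous 2) (hG2 : G.IsHomogeneous 2)
    (hFirr : Irreducible F) (hGirr : Irreducible G)
    (hFG : LinearIndependent ℂ ![F, G])
    (hMSF : ¬(MS F ≤ Submodule.span ℂ (Set.range v)))
    (hMSG : ¬(MS G ≤ Submodule.span ℂ (Set.range v)))
    (T : (Fin Δ → ℝ) → (MvPolynomial (Fin n) ℂ →ₐ[ℂ] MvPolynomial (Option (Fin n)) ℂ))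
    (hTv : ∀ α i, T α (v i) = ((α i : ℂ)) • X (none : Option (Fin n)))
    (hTu : ∀ α j, T α (u j) = rename (some : Fin n → Option (Fin n)) (u j)) :
    ∀ᵐ α ∂(volume.restrict (Set.univ.pi fun _ : Fin Δ => Set.Icc (0 : ℝ) 1)),
      LinearIndependent ℂ ![T α F, T α G] := by
  have hΦ : ∃ Φ : MvPolynomial (Fin n) ℂ ≃ₐ[ℂ]
      MvPolynomial (Fin (n - Δ)) (MvPolynomial (Fin Δ) ℂ),
      (∀ i, Φ (v i) = C (X i)) ∧ ∀ j, Φ (u j) = X j := by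
    have hspan' := hspan
    rw [Set.union_comm, ← Set.Sum.elim_range] at hspan'
    obtain ⟨e, he⟩ := exists_algEquiv_apply_eq_X (Sum.elim u v)
      (by simpa using hindep.comp _ (Equiv.sumComm _ _).injective) hspan'
    refine ⟨e.trans (sumAlgEquiv ℂ _ _), fun i => ?_, fun j => ?_⟩
    · have := he (Sum.inr i)
      simp only [Sum.elim_inr] at this
      simp [this]
    · have := he (Sum.inl j)
      simp only [Sum.elim_inl] at this
      simp [this]
  obtain ⟨Φ, hΦv, hΦu⟩ := hΦ
  have hspanVU : ∀ a : MvPolynomial (Fin n) ℂ, a.IsHomogeneous 1 →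
      a ∈ Submodule.span ℂ (Set.range v ∪ Set.range u) := fun a ha => by
    rw [hspan, ← homogeneousSubmodule_one_eq_span_X]
    exact ha
  -- Specialising the coordinates `v` at `α` and keeping the coordinates `u`.
  let R : (Fin Δ → ℂ) → (MvPolynomial (Fin n) ℂ →ₐ[ℂ] MvPolynomial (Fin (n - Δ)) ℂ) :=
    fun α => (mapAlgHom (aeval α)).comp (Φ : _ →ₐ[ℂ] _)
  have hRv : ∀ α i, R α (v i) = C (α i) := fun α i => by simp [R, hΦv]
  have hRu : ∀ α j, R α (u j) = X j := fun α j => by simp [R, hΦu]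
  have hRcoeff : ∀ α d p, coeff d (R α p) = eval α (coeff d (Φ p)) := fun α d p => by
    simp [R, coeff_map]
  let s : MvPolynomial (Option (Fin n)) ℂ →ₐ[ℂ] MvPolynomial (Fin (n - Δ)) ℂ :=
    aeval fun o => o.elim 1 fun i => R 0 (X i)
  have hs_rename : ∀ p, s (rename some p) = R 0 p := fun p => by
    have : s.comp (rename some) = R 0 := by ext1 i; simp [s]
    exact DFunLike.congr_fun this p
  have hsT : ∀ α : Fin Δ → ℝ, s.comp (T α) = R fun i => (α i : ℂ) := fun α => by
    ext1 i
    have hlin : Set.EqOn (s.comp (T α)).toLinearMap (R fun i => (α i : ℂ)).toLinearMap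
        (Submodule.span ℂ (Set.range v ∪ Set.range u)) := by
      refine LinearMap.eqOn_span' ?_
      rintro _ (⟨i, rfl⟩ | ⟨j, rfl⟩)
      · simp only [AlgHom.toLinearMap_apply, AlgHom.comp_apply, hTv, hRv, map_smul, C_eq_smul_one]
        simp [s]
      · simp [hTu, hRu, hs_rename]
    exact hlin (hspanVU _ (isHomogeneous_X ℂ i))
  have hminor : ∃ d e, coeff d (Φ F) * coeff e (Φ G) - coeff e (Φ F) * coeff d (Φ G) ≠ 0 := by
    by_contra! hzero
    have hndvd : ¬ Φ F ∣ Φ G := fun h => by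
      obtain ⟨w, hw⟩ := hFirr.associated_of_dvd hGirr ((map_dvd_iff Φ).1 h)
      obtain ⟨c, -, hc⟩ := isUnit_iff_eq_C_of_isReduced.1 w.isUnit
      refine (LinearIndependent.pair_iff' hFirr.ne_zero).1 hFG c ?_
      rw [← hw, hc, mul_comm, C_mul']
    obtain ⟨a, ha⟩ := exists_eq_C_of_coeff_minors_eq_zero
      ((MulEquiv.prime_iff Φ).2 hFirr.prime) hndvd hzero
    let π : MvPolynomial (Fin n) ℂ →ₐ[ℂ] MvPolynomial (Fin n) ℂ :=
      (aeval v).comp (((aeval fun _ : Fin (n - Δ) => (0 : MvPolynomial (Fin Δ) ℂ)).restrictScalars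
        ℂ).comp Φ.toAlgHom)
    have hπv : ∀ i, π (v i) = v i := fun i => by simp [π, hΦv]
    have hπu : ∀ j, π (u j) = 0 := fun j => by simp [π, hΦu]
    refine hMSF (MS_le_of_algHom_apply_eq hF2 (Submodule.span_le.2 ?_) π ?_ ?_)
    · rintro _ ⟨i, rfl⟩
      exact hv i
    · intro a ha
      refine (Submodule.span_le (p := (Submodule.span ℂ (Set.range v)).comap π.toLinearMap)).2 ?_
        (hspanVU a ha)
      rintro _ (⟨i, rfl⟩ | ⟨j, rfl⟩)
      · simpa [hπv] using Submodule.subset_span (Set.mem_range_self i)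
      · simp [hπu]
    · apply Φ.injective
      have hΦbind : Φ.toAlgHom.comp (bind₁ v) = IsScalarTower.toAlgHom ℂ _ _ := by
        ext1 i
        simp [hΦv, algebraMap_eq]
      have hΦa : Φ (bind₁ v a) = C a := DFunLike.congr_fun hΦbind a
      simp [π, ha, hΦa]
  obtain ⟨d, e, hde⟩ := hminor
  refine ae_restrict_of_ae ?_
  filter_upwards [ae_eval_ofReal_ne_zero_s9 hde] with α hα
  have hli : LinearIndependent ℂ ![R (fun i => (α i : ℂ)) F, R (fun i => (α i : ℂ)) G] :=
    linearIndependent_pair_of_coeff (d := d) (e := e) (by simpa [hRcoeff] using hα)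
  refine LinearIndependent.of_comp s.toLinearMap ?_
  have hcomp : s.toLinearMap ∘ ![T α F, T α G]
      = ![R (fun i => (α i : ℂ)) F, R (fun i => (α i : ℂ)) G] := by
    funext i
    fin_cases i <;> simp [← hsT]
  rw [hcomp]
  exact hli
end
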